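/- arXiv:2108.07300 — 2 statements merged into one kernel-verified Lean document; each statement's English description precedes it below -/
import Mathlib

section
/- Assume |S(a,b)| ≤ A_S for all a,b ∈ ℝ (i.e. B_S = 0) and that S is L_S-Lipschitz in each pair of arguments. Let f : [0,T] × ℝ → ℝ be continuous with |f(t,v)| ≤ A_f + B_f|v| and |f(t,v) − f(t,v')| ≤ L_f|v − v'|. Let g ∈ L²(I^d), let w : [0,T] → L²(I^d) be continuous, let u : [0,T] → L²(I^d) be the unique continuous solution of u(t) = g + ∫₀ᵗ [ f(s,u(s)) + 𝐊_K[u(s)] ] ds + w(t), and let u^n : [0,T] → L²(I^d) be the unique continuous solution of u^n(t) = P_n g + ∫₀ᵗ [ f(s,u^n(s)) + 𝐊_{P_n K}[u^n(s)] ] ds + P_n w(t), where P_n K is the cell average of K over the products of cubes V_ī × V_j̄. Then sup_{t ∈ [0,T]} ‖u(t) − u^n(t)‖_{L²(I^d)} ≤ e^{(√(2(K₁+K₂)) L_S + L_f) T} · ( ‖g − P_n g‖_{L²(I^d)} + T A_S ‖K − P_n^{(1)} K‖_{L²(I^d×I^d)} + sup_{t ∈ [0,T]} ‖w(t) − P_n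 w(t)‖_{L²(I^d)} ), where (P_n^{(1)} K)(x,y) = n^d ∫_{V_ī} K(z,y) dz for x ∈ V_ī is the cell average of K in its first variable only. -/
open MeasureTheory Set intervalIntegral

noncomputable section

/-- The unit cube `I^d ⊆ ℝ^d`. -/
def unitCube (d : ℕ) : Set (Fin d → ℝ) := Set.Icc 0 1

/-- Lebesgue measure restricted to the unit cube. -/
def cubeMeasure (d : ℕ) : Measure (Fin d → ℝ) := volume.restrict (unitCube d)

/-- The half-open cell `∏_l ((i_l−1)/n, i_l/n]` of the uniform partition of `I^d`
into `n^d` cubes that contains the point `x` (here `i_l = ⌈n x_l⌉`). -/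
def cellOf (d n : ℕ) (x : Fin d → ℝ) : Set (Fin d → ℝ) :=
  Set.univ.pi fun l => Set.Ioc (((⌈(n : ℝ) * x l⌉ : ℝ) - 1) / n) ((⌈(n : ℝ) * x l⌉ : ℝ) / n)

/-- The cell-averaging operator `P_n` on `I^d`. -/
def cellAvg (d n : ℕ) (φ : (Fin d → ℝ) → ℝ) (x : Fin d → ℝ) : ℝ :=
  (n : ℝ) ^ d * ∫ z in cellOf d n x, φ z

/-- The cell average `P_n^{(1)} K` of a kernel in its first variable only. -/
def cellAvgFst (d n : ℕ) (K : (Fin d → ℝ) → (Fin d → ℝ) → ℝ)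
    (x y : Fin d → ℝ) : ℝ :=
  (n : ℝ) ^ d * ∫ z in cellOf d n x, K z y

/-- The cell average `P_n K` of a kernel over products of cubes `V_ī × V_j̄`. -/
def cellAvgKer (d n : ℕ) (K : (Fin d → ℝ) → (Fin d → ℝ) → ℝ)
    (x y : Fin d → ℝ) : ℝ :=
  (n : ℝ) ^ d * ((n : ℝ) ^ d * ∫ z in cellOf d n x, ∫ z' in cellOf d n y, K z z')


lemma gal_gronwall {T L C : ℝ} (hT : 0 ≤ T) (hL : 0 ≤ L) {e : ℝ → ℝ}
    (he : ContinuousOn e (Set.Icc 0 T))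
    (h : ∀ t ∈ Set.Icc (0:ℝ) T, e t ≤ C + ∫ s in (0:ℝ)..t, L * e s) :
    ∀ t ∈ Set.Icc (0:ℝ) T, e t ≤ C * Real.exp (L * t) := by
  set e' : ℝ → ℝ := Set.IccExtend hT (Set.domRestrict (Set.Icc 0 T) e) with he'
  have hc : Continuous e' := (continuousOn_iff_continuous_domRestrict.1 he).Icc_extend'
  have heq : ∀ t ∈ Set.Icc (0:ℝ) T, e' t = e t := fun t ht => by
    rw [he', Set.IccExtend_of_mem _ _ ht]; rfl
  set F : ℝ → ℝ := fun t => C + ∫ s in (0:ℝ)..t, L * e' s with hF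
  have hFd : ∀ t, HasDerivAt F (L * e' t) t := fun t => by
    have := intervalIntegral.integral_hasDerivAt_right (a := 0) (b := t)
      ((continuous_const.mul hc).intervalIntegrable (μ := volume) 0 t)
      (Continuous.stronglyMeasurableAtFilter (continuous_const.mul hc) _ _) 
      ((continuous_const (y := L)).mul hc).continuousAt
    exact this.const_add C
  have hle : ∀ t ∈ Set.Icc (0:ℝ) T, e t ≤ F t := fun t ht => by
    refine (h t ht).trans (le_of_eq ?_)
    simp only [hF]
    congr 1
    apply intervalIntegral.integral_congr
    intro s hs
    rw [Set.uIcc_of_le ht.1] at hs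
    simp only
    rw [heq s ⟨hs.1, hs.2.trans ht.2⟩]
  have key := le_gronwallBound_of_liminf_deriv_right_le (f := F) (f' := fun t => L * e' t)
    (δ := C) (K := L) (ε := 0) (a := 0) (b := T)
    (fun t _ => (hFd t).continuousAt.continuousWithinAt)
    (fun t _ r hr => ((hFd t).hasDerivWithinAt (s := Set.Ici t)).liminf_right_slope_le hr)
    (by simp [hF]) (fun t ht => by
      have : t ∈ Set.Icc (0:ℝ) T := ⟨ht.1, ht.2.le⟩
      rw [add_zero]
      exact mul_le_mul_of_nonneg_left (by rw [heq t this]; exact hle t this) hL)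
  intro t ht
  have := key t ht
  rw [gronwallBound_ε0, sub_zero] at this
  exact (hle t ht).trans this

lemma gal_mem_subspace {H : Type*} [NormedAddCommGroup H] [InnerProductSpace ℝ H] [CompleteSpace H]
    (V : Submodule ℝ H) [V.HasOrthogonalProjection] {T L : ℝ} (hT : 0 ≤ T) (hL : 0 ≤ L)
    (G : ℝ → H → H)
    (hGV : ∀ s ∈ Set.Icc (0:ℝ) T, ∀ v ∈ V, G s v ∈ V)
    (hGL : ∀ s ∈ Set.Icc (0:ℝ) T, ∀ v v', ‖G s v - G s v'‖ ≤ L * ‖v - v'‖)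
    (u a : ℝ → H) (hu : ContinuousOn u (Set.Icc 0 T))
    (hGu : ContinuousOn (fun s => G s (u s)) (Set.Icc 0 T))
    (ha : ∀ t ∈ Set.Icc (0:ℝ) T, a t ∈ V)
    (heq : ∀ t ∈ Set.Icc (0:ℝ) T, u t = a t + ∫ s in (0:ℝ)..t, G s (u s)) :
    ∀ t ∈ Set.Icc (0:ℝ) T, u t ∈ V := by
  set R : H →L[ℝ] H := ContinuousLinearMap.id ℝ H - V.starProjection with hR
  have hRV : ∀ v ∈ V, R v = 0 := fun v hv => by
    simp [hR, Submodule.starProjection_eq_self_iff.2 hv]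
  have hRn : ∀ v, ‖R v‖ ≤ ‖v‖ := fun v => by
    have : R v = Vᗮ.starProjection v := by
      simp [hR, Submodule.starProjection_orthogonal]
    rw [this]
    exact Submodule.norm_starProjection_apply_le _ _
  have hint : ∀ t ∈ Set.Icc (0:ℝ) T,
      IntervalIntegrable (fun s => G s (u s)) volume 0 t := fun t ht =>
    (hGu.mono (by rw [Set.uIcc_of_le ht.1]; exact Set.Icc_subset_Icc_right ht.2)).intervalIntegrable
  have hRc : ContinuousOn (fun t => ‖R (u t)‖) (Set.Icc 0 T) :=
    (R.continuous.comp_continuousOn hu).norm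
  have key := gal_gronwall (C := 0) hT hL hRc (fun t ht => by
    rw [heq t ht, map_add, hRV _ (ha t ht), zero_add, zero_add,
      ← R.intervalIntegral_comp_comm (hint t ht)]
    apply intervalIntegral.norm_integral_le_of_norm_le ht.1
    · refine Filter.Eventually.of_forall fun s hs => ?_
      have hs' : s ∈ Set.Icc (0:ℝ) T := ⟨hs.1.le, hs.2.trans ht.2⟩
      have h1 : R (G s (u s)) = R (G s (u s) - G s (V.starProjection (u s))) := by
        rw [map_sub, hRV _ (hGV s hs' _ (Submodule.starProjection_apply_mem _ _)), sub_zero]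
      rw [h1]
      refine (hRn _).trans ((hGL s hs' _ _).trans (le_of_eq ?_))
      simp [hR]
    · exact (ContinuousOn.mono (continuousOn_const.mul hRc)
        (by rw [Set.uIcc_of_le ht.1]; exact Set.Icc_subset_Icc_right ht.2)).intervalIntegrable)
  intro t ht
  have := key t ht
  rw [zero_mul, norm_le_zero_iff] at this
  rw [← Submodule.starProjection_eq_self_iff (K := V)]
  have h2 : u t - V.starProjection (u t) = 0 := by simpa [hR] using this
  exact (sub_eq_zero.1 h2).symm

lemma gal_jensen {Ω : Type*} [MeasurableSpace Ω] {μ : Measure Ω} [IsProbabilityMeasure μ]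
    {h : Ω → ℝ} (hm : AEStronglyMeasurable h μ) (hi : Integrable (fun x => h x ^ 2) μ) :
    (∫ x, h x ∂μ) ^ 2 ≤ ∫ x, h x ^ 2 ∂μ := by
  have h2 : MemLp h 2 μ := (memLp_two_iff_integrable_sq hm).2 hi
  have := ProbabilityTheory.variance_nonneg h μ
  rw [ProbabilityTheory.variance_eq_sub h2] at this
  simpa using this

lemma gal_norm_sq {Ω : Type*} [MeasurableSpace Ω] {μ : Measure Ω} (v : Lp ℝ 2 μ) :
    ‖v‖ ^ 2 = ∫ x, v x ^ 2 ∂μ := by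
  rw [← real_inner_self_eq_norm_sq, L2.inner_def]
  simp [sq]

lemma gal_sq_integrable {Ω : Type*} [MeasurableSpace Ω] {μ : Measure Ω} (v : Lp ℝ 2 μ) :
    Integrable (fun x => v x ^ 2) μ := 
  (memLp_two_iff_integrable_sq (Lp.aestronglyMeasurable v)).1 (Lp.memLp v)

/-- Lipschitz bound for the drift. -/
lemma gal_lip {Ω : Type*} [MeasurableSpace Ω] {μ : Measure Ω} [IsProbabilityMeasure μ]
    (M : Ω → Ω → ℝ) (hM : Measurable (Function.uncurry M)) (M₁ M₂ : ℝ)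
    (hM1 : ∀ᵐ x ∂μ, Integrable (fun y => (M x y) ^ 2) μ ∧ (∫ y, (M x y) ^ 2 ∂μ) ≤ M₁)
    (hM2 : ∀ᵐ y ∂μ, Integrable (fun x => (M x y) ^ 2) μ ∧ (∫ x, (M x y) ^ 2 ∂μ) ≤ M₂)
    (S : ℝ → ℝ → ℝ) (hS : Continuous (Function.uncurry S))
    (A_S L_S : ℝ) (hLS : 0 ≤ L_S)
    (hSbound : ∀ a b : ℝ, |S a b| ≤ A_S)
    (hSlip : ∀ a b a' b' : ℝ, |S a b - S a' b'| ≤ L_S * (|a - a'| + |b - b'|))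
    (φ : ℝ → ℝ) (hφ : Continuous φ) (L_f : ℝ)
    (hφl : ∀ v v' : ℝ, |φ v - φ v'| ≤ L_f * |v - v'|)
    (v v' D D' : Lp ℝ 2 μ)
    (hD : D =ᵐ[μ] fun x => φ (v x) + ∫ y, M x y * S (v x) (v y) ∂μ)
    (hD' : D' =ᵐ[μ] fun x => φ (v' x) + ∫ y, M x y * S (v' x) (v' y) ∂μ) :
    ‖D - D'‖ ≤ (Real.sqrt (2 * (M₁ + M₂)) * L_S + L_f) * ‖v - v'‖ := by
  have hvm := Lp.aestronglyMeasurable v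
  have hvm' := Lp.aestronglyMeasurable v'
  have hsub := Lp.coeFn_sub v v'
  have hFm : MemLp (fun x => φ (v x) - φ (v' x)) 2 μ := by
    refine MemLp.of_le_mul (c := L_f) (Lp.memLp (v - v')) 
      ((hφ.comp_aestronglyMeasurable hvm).sub (hφ.comp_aestronglyMeasurable hvm')) ?_
    filter_upwards [hsub] with x hx
    rw [hx]
    exact hφl _ _
  set F : Lp ℝ 2 μ := hFm.toLp with hF
  have hFae := hFm.coeFn_toLp
  have hFn : ‖F‖ ≤ L_f * ‖v - v'‖ := by
    apply Lp.norm_le_mul_norm_of_ae_le_mul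
    filter_upwards [hsub, hFae] with x hx hx2
    rw [hx, hF, hx2]
    exact hφl _ _
  set e : Lp ℝ 2 μ := v - v' with he
  have hem := Lp.aestronglyMeasurable e
  have hmprod : AEStronglyMeasurable (fun p : Ω × Ω => M p.1 p.2 ^ 2 * e p.2 ^ 2) (μ.prod μ) := 
    (hM.pow_const 2).aestronglyMeasurable.mul (hem.comp_snd.pow 2)
  have hprod : Integrable (fun p : Ω × Ω => M p.1 p.2 ^ 2 * e p.2 ^ 2) (μ.prod μ) := by
    rw [integrable_prod_iff' hmprod]
    refine ⟨?_, ?_⟩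
    · filter_upwards [hM2] with y hy
      exact hy.1.mul_const _
    · refine Integrable.mono' ((gal_sq_integrable e).const_mul M₂)
        hmprod.norm.prod_swap.integral_prod_right' ?_
      filter_upwards [hM2] with y hy
      simp only [norm_mul, norm_pow, Real.norm_eq_abs, sq_abs]
      rw [MeasureTheory.integral_mul_const, abs_of_nonneg (mul_nonneg (integral_nonneg fun _ => sq_nonneg _) (sq_nonneg _))]
      exact mul_le_mul_of_nonneg_right hy.2 (sq_nonneg _)
  have hI : ∫ x, ∫ y, M x y ^ 2 * e y ^ 2 ∂μ ∂μ ≤ M₂ * ‖e‖ ^ 2 := by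
    rw [integral_integral_swap hprod, gal_norm_sq, ← MeasureTheory.integral_const_mul]
    apply MeasureTheory.integral_mono_ae hprod.integral_prod_right ((gal_sq_integrable e).const_mul M₂)
    filter_upwards [hM2] with y hy
    rw [MeasureTheory.integral_mul_const]
    exact mul_le_mul_of_nonneg_right hy.2 (sq_nonneg _)
  have hrow := hprod.prod_right_ae
  have hpt : ∀ᵐ x ∂μ, ((D - D' - F : Lp ℝ 2 μ) x) ^ 2 ≤
      2 * L_S ^ 2 * (M₁ * e x ^ 2 + ∫ y, M x y ^ 2 * e y ^ 2 ∂μ) := by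
    filter_upwards [Lp.coeFn_sub (D - D') F, Lp.coeFn_sub D D', hD, hD', hFae, hsub, hM1, hrow]
      with x h1 h2 h3 h4 h5 h6 h7 h8
    have hMx : Measurable (M x) := hM.comp measurable_prodMk_left
    have hMm : MemLp (M x) 2 μ := (memLp_two_iff_integrable_sq hMx.aestronglyMeasurable).2 h7.1
    have hMi : Integrable (M x) μ := hMm.integrable (by norm_num)
    have hSm : ∀ (a : ℝ) (q : Lp ℝ 2 μ), AEStronglyMeasurable (fun y => S a (q y)) μ := fun a q =>
      (hS.comp (continuous_const.prodMk continuous_id) : Continuous (fun b => S a b)).comp_aestronglyMeasurable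
        (Lp.aestronglyMeasurable q)
    have hSi : ∀ (a : ℝ) (q : Lp ℝ 2 μ), Integrable (fun y => M x y * S a (q y)) μ := fun a q =>
      hMi.mul_bdd (c := A_S) (hSm a q) (Filter.Eventually.of_forall fun y => hSbound _ _)
    have hval : (D - D' - F : Lp ℝ 2 μ) x = 
        ∫ y, M x y * (S (v x) (v y) - S (v' x) (v' y)) ∂μ := by
      rw [h1, Pi.sub_apply, h2, Pi.sub_apply, h3, h4, hF, h5]
      simp only [mul_sub]
      rw [MeasureTheory.integral_sub (hSi _ _) (hSi _ _)]
      ring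
    rw [hval]
    have hb : Integrable (fun y => 2 * L_S ^ 2 * (e x ^ 2 * M x y ^ 2 + M x y ^ 2 * e y ^ 2)) μ :=
      ((h7.1.const_mul _).add h8).const_mul _
    have hple : ∀ᵐ y ∂μ, (M x y * (S (v x) (v y) - S (v' x) (v' y))) ^ 2 ≤
        2 * L_S ^ 2 * (e x ^ 2 * M x y ^ 2 + M x y ^ 2 * e y ^ 2) := by
      filter_upwards [hsub] with y hy
      have hl := hSlip (v x) (v y) (v' x) (v' y)
      rw [Pi.sub_apply] at hy h6
      rw [← h6, ← hy] at hl
      have hsq : (S (v x) (v y) - S (v' x) (v' y)) ^ 2 ≤ (L_S * (|e x| + |e y|)) ^ 2 := by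
        rw [← sq_abs]
        exact pow_le_pow_left₀ (abs_nonneg _) hl 2
      have h9 : (|e x| + |e y|) ^ 2 ≤ 2 * (e x ^ 2 + e y ^ 2) := by
        have := sq_nonneg (|e x| - |e y|)
        nlinarith [sq_abs (e x), sq_abs (e y)]
      calc _ = M x y ^ 2 * (S (v x) (v y) - S (v' x) (v' y)) ^ 2 := by ring
        _ ≤ M x y ^ 2 * (L_S ^ 2 * (2 * (e x ^ 2 + e y ^ 2))) := by
          refine mul_le_mul_of_nonneg_left (hsq.trans ?_) (sq_nonneg _)
          rw [mul_pow]
          exact mul_le_mul_of_nonneg_left h9 (sq_nonneg _)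
        _ = _ := by ring
    have hmeas : AEStronglyMeasurable (fun y => M x y * (S (v x) (v y) - S (v' x) (v' y))) μ :=
      hMx.aestronglyMeasurable.mul ((hSm _ _).sub (hSm _ _))
    have hint : Integrable (fun y => (M x y * (S (v x) (v y) - S (v' x) (v' y))) ^ 2) μ := by
      refine hb.mono' (hmeas.pow 2) ?_
      filter_upwards [hple] with y hy
      rw [Real.norm_eq_abs, abs_of_nonneg (sq_nonneg _)]
      exact hy
    calc _ ≤ ∫ y, (M x y * (S (v x) (v y) - S (v' x) (v' y))) ^ 2 ∂μ := gal_jensen hmeas hint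
      _ ≤ ∫ y, 2 * L_S ^ 2 * (e x ^ 2 * M x y ^ 2 + M x y ^ 2 * e y ^ 2) ∂μ :=
        MeasureTheory.integral_mono_ae hint hb hple
      _ = 2 * L_S ^ 2 * (e x ^ 2 * (∫ y, M x y ^ 2 ∂μ) + ∫ y, M x y ^ 2 * e y ^ 2 ∂μ) := by
        rw [MeasureTheory.integral_const_mul, MeasureTheory.integral_add (h7.1.const_mul _) h8, MeasureTheory.integral_const_mul]
      _ ≤ _ := by
        refine mul_le_mul_of_nonneg_left ?_ (by positivity)
        have := mul_le_mul_of_nonneg_left h7.2 (sq_nonneg (e x))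
        linarith
  have hsqn : ‖D - D' - F‖ ^ 2 ≤ (2 * (M₁ + M₂)) * (L_S * ‖e‖) ^ 2 := by
    rw [gal_norm_sq]
    have hrowi : Integrable (fun x => ∫ y, M x y ^ 2 * e y ^ 2 ∂μ) μ := hprod.integral_prod_left
    calc _ ≤ ∫ x, 2 * L_S ^ 2 * (M₁ * e x ^ 2 + ∫ y, M x y ^ 2 * e y ^ 2 ∂μ) ∂μ :=
          MeasureTheory.integral_mono_ae (gal_sq_integrable _)
            ((((gal_sq_integrable e).const_mul M₁).add hrowi).const_mul _) hpt
      _ = 2 * L_S ^ 2 * (M₁ * ‖e‖ ^ 2 + ∫ x, ∫ y, M x y ^ 2 * e y ^ 2 ∂μ ∂μ) := by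
          rw [MeasureTheory.integral_const_mul, MeasureTheory.integral_add ((gal_sq_integrable e).const_mul M₁) hrowi,
            MeasureTheory.integral_const_mul, gal_norm_sq e]
      _ ≤ 2 * L_S ^ 2 * (M₁ * ‖e‖ ^ 2 + M₂ * ‖e‖ ^ 2) := by
          refine mul_le_mul_of_nonneg_left ?_ (by positivity)
          linarith
      _ = _ := by ring
  have hn : ‖D - D' - F‖ ≤ Real.sqrt (2 * (M₁ + M₂)) * (L_S * ‖e‖) := by
    have := Real.le_sqrt_of_sq_le hsqn
    rwa [Real.sqrt_mul' _ (sq_nonneg _), Real.sqrt_sq (by positivity)] at this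
  calc ‖D - D'‖ = ‖(D - D' - F) + F‖ := by rw [sub_add_cancel]
    _ ≤ ‖D - D' - F‖ + ‖F‖ := norm_add_le _ _
    _ ≤ _ := by linarith

/-- Continuity in time of the drift along a continuous path. -/
lemma gal_cont {Ω : Type*} [MeasurableSpace Ω] {μ : Measure Ω} [IsProbabilityMeasure μ]
    {T L A B : ℝ} (f : ℝ → ℝ → ℝ) (hf : Continuous (Function.uncurry f))
    (hfb : ∀ t ∈ Set.Icc (0:ℝ) T, ∀ v : ℝ, |f t v| ≤ A + B * |v|)
    (G : ℝ → Lp ℝ 2 μ → Lp ℝ 2 μ) (Z : Lp ℝ 2 μ → Ω → ℝ)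
    (hG : ∀ s ∈ Set.Icc (0:ℝ) T, ∀ v : Lp ℝ 2 μ, G s v =ᵐ[μ] fun x => f s (v x) + Z v x)
    (hGL : ∀ s ∈ Set.Icc (0:ℝ) T, ∀ v v', ‖G s v - G s v'‖ ≤ L * ‖v - v'‖)
    (u : ℝ → Lp ℝ 2 μ) (hu : ContinuousOn u (Set.Icc 0 T)) :
    ContinuousOn (fun s => G s (u s)) (Set.Icc 0 T) := by
  intro s0 hs0
  set v := u s0 with hv
  have h2 : Filter.Tendsto (fun s => ‖G s v - G s0 v‖ ^ 2) (nhdsWithin s0 (Set.Icc 0 T)) (nhds 0) := by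
    have heq : ∀ᶠ s in nhdsWithin s0 (Set.Icc 0 T), 
        ∫ x, (f s (v x) - f s0 (v x)) ^ 2 ∂μ = ‖G s v - G s0 v‖ ^ 2 := by
      filter_upwards [self_mem_nhdsWithin] with s hs
      rw [gal_norm_sq]
      apply MeasureTheory.integral_congr_ae
      filter_upwards [Lp.coeFn_sub (G s v) (G s0 v), hG s hs v, hG s0 hs0 v] with x h1 h2 h3
      rw [h1, Pi.sub_apply, h2, h3]
      ring
    refine Filter.Tendsto.congr' heq ?_
    suffices hz : Filter.Tendsto (fun s => ∫ x, (f s (v x) - f s0 (v x)) ^ 2 ∂μ)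
        (nhdsWithin s0 (Set.Icc 0 T)) (nhds (∫ x, (fun _ => (0:ℝ)) x ∂μ)) by simpa using hz
    have hfs : ∀ s, Continuous (f s) := fun s =>
      hf.comp (continuous_const.prodMk continuous_id)
    refine tendsto_integral_filter_of_dominated_convergence 
      (fun x => (2 * (A + B * |v x|)) ^ 2) ?_ ?_ ?_ ?_
    · refine Filter.Eventually.of_forall fun s => ?_
      exact (((hfs s).comp_aestronglyMeasurable (Lp.aestronglyMeasurable v)).sub
        ((hfs s0).comp_aestronglyMeasurable (Lp.aestronglyMeasurable v))).pow 2
    · filter_upwards [self_mem_nhdsWithin] with s hs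
      refine Filter.Eventually.of_forall fun x => ?_
      rw [Real.norm_eq_abs, abs_pow]
      refine pow_le_pow_left₀ (abs_nonneg _) ?_ 2
      have := abs_sub (f s (v x)) (f s0 (v x))
      linarith [hfb s hs (v x), hfb s0 hs0 (v x)]
    · have hm : MemLp (fun x => 2 * (A + B * |v x|)) 2 μ := 
        (((memLp_const A).add ((Lp.memLp v).abs.const_mul B)).const_mul 2)
      exact hm.integrable_sq
    · refine Filter.Eventually.of_forall fun x => ?_
      have hc : Continuous (fun s => (f s (v x) - f s0 (v x)) ^ 2) :=
        ((hf.comp (continuous_id.prodMk continuous_const)).sub continuous_const).pow 2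
      have := (hc.tendsto s0).mono_left (nhdsWithin_le_nhds (s := Set.Icc 0 T))
      simpa using this
  have h3 : Filter.Tendsto (fun s => ‖G s v - G s0 v‖) (nhdsWithin s0 (Set.Icc 0 T)) (nhds 0) := by
    have := h2.sqrt
    simpa [Real.sqrt_sq] using this
  have h4 : Filter.Tendsto (fun s => L * ‖u s - v‖) (nhdsWithin s0 (Set.Icc 0 T)) (nhds 0) := by
    have := ((hu s0 hs0).tendsto.sub_const v).norm.const_mul L
    simpa [← hv] using this
  refine tendsto_iff_norm_sub_tendsto_zero.2 ?_
  have h5 := h4.add h3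
  rw [add_zero] at h5
  refine squeeze_zero' (Filter.Eventually.of_forall fun _ => norm_nonneg _) ?_ h5
  filter_upwards [self_mem_nhdsWithin] with s hs
  calc ‖G s (u s) - G s0 v‖ = ‖(G s (u s) - G s v) + (G s v - G s0 v)‖ := by congr 1; abel
    _ ≤ ‖G s (u s) - G s v‖ + ‖G s v - G s0 v‖ := norm_add_le _ _
    _ ≤ _ := by gcongr; exact hGL s hs _ _

/-- The index of the cell containing a point. -/
def galC (d n : ℕ) (x : Fin d → ℝ) : Fin d → ℤ := fun l => ⌈(n : ℝ) * x l⌉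

/-- The half-open unit cube. -/
def galU (d : ℕ) : Set (Fin d → ℝ) := Set.univ.pi fun _ => Set.Ioc 0 1

lemma galC_measurable (d n : ℕ) : Measurable (galC d n) := by
  refine measurable_pi_lambda _ fun l => ?_
  exact Int.measurable_ceil.comp (measurable_const.mul (measurable_pi_apply l))

lemma galU_measurable (d : ℕ) : MeasurableSet (galU d) :=
  MeasurableSet.univ_pi fun _ => measurableSet_Ioc

lemma gal_cube_eq (d : ℕ) : cubeMeasure d = volume.restrict (galU d) := by
  unfold cubeMeasure unitCube galU
  refine Measure.restrict_congr_set ?_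
  exact (Measure.univ_pi_Ioc_ae_eq_Icc (f := fun _ : Fin d => (0:ℝ)) (g := fun _ => 1)).symm

instance gal_prob (d : ℕ) : IsProbabilityMeasure (cubeMeasure d) := by
  refine ⟨?_⟩
  rw [gal_cube_eq, Measure.restrict_apply_univ, galU, Real.volume_pi_Ioc]
  simp

lemma gal_cell_eq {d n : ℕ} (hn : 1 ≤ n) (x : Fin d → ℝ) :
    cellOf d n x = galC d n ⁻¹' {galC d n x} := by
  have hn' : (0:ℝ) < n := by exact_mod_cast hn
  ext z
  simp only [cellOf, galC, Set.mem_univ_pi, Set.mem_Ioc, Set.mem_preimage, Set.mem_singleton_iff,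
    funext_iff]
  refine forall_congr' fun l => ?_
  rw [Int.ceil_eq_iff, div_lt_iff₀ hn', le_div_iff₀ hn', mul_comm (z l)]

lemma gal_cell_meas {d n : ℕ} (hn : 1 ≤ n) (x : Fin d → ℝ) : MeasurableSet (cellOf d n x) := by
  rw [gal_cell_eq hn]
  exact galC_measurable d n (measurableSet_singleton _)

lemma gal_cell_congr {d n : ℕ} (hn : 1 ≤ n) {x y : Fin d → ℝ} (h : galC d n x = galC d n y) :
    cellOf d n x = cellOf d n y := by
  rw [gal_cell_eq hn, gal_cell_eq hn, h]

lemma gal_cell_subset {d n : ℕ} (hn : 1 ≤ n) {x : Fin d → ℝ} (hx : x ∈ galU d) :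
    cellOf d n x ⊆ galU d := by
  have hn' : (0:ℝ) < n := by exact_mod_cast hn
  rw [gal_cell_eq hn]
  intro z hz l hl
  have hzl : ⌈(n : ℝ) * z l⌉ = ⌈(n : ℝ) * x l⌉ := congrFun hz l
  have hxl := hx l hl
  have h1 : 0 < ⌈(n : ℝ) * x l⌉ := Int.ceil_pos.2 (mul_pos hn' hxl.1)
  have h2 : ⌈(n : ℝ) * x l⌉ ≤ (n : ℤ) := Int.ceil_le.2 (by
    have := mul_le_mul_of_nonneg_left hxl.2 hn'.le
    simpa using this)
  rw [← hzl] at h1 h2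
  refine ⟨?_, ?_⟩
  · exact pos_of_mul_pos_right (Int.ceil_pos.1 h1) hn'.le
  · have := Int.ceil_le.1 h2
    push_cast at this
    nlinarith

lemma gal_cell_vol {d n : ℕ} (hn : 1 ≤ n) (x : Fin d → ℝ) :
    (n : ℝ) ^ d * volume.real (cellOf d n x) = 1 := by
  have hn' : (0:ℝ) < n := by exact_mod_cast hn
  rw [measureReal_def, cellOf, Real.volume_pi_Ioc_toReal]
  · have : ∀ l : Fin d, (⌈(n : ℝ) * x l⌉ : ℝ) / n - ((⌈(n : ℝ) * x l⌉ : ℝ) - 1) / n = (n:ℝ)⁻¹ := by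
      intro l
      field_simp
      ring
    simp only [this, Finset.prod_const, Finset.card_univ, Fintype.card_fin]
    rw [← mul_pow, mul_inv_cancel₀ hn'.ne', one_pow]
  · intro l
    simp only
    gcongr
    linarith

lemma gal_ae_mem (d : ℕ) : ∀ᵐ x ∂cubeMeasure d, x ∈ galU d := by
  rw [gal_cube_eq]
  exact ae_restrict_mem (galU_measurable d)

/-- A function of the cell index is measurable. -/
lemma gal_meas_of_idx {d n : ℕ} {β : Type*} [MeasurableSpace β] (F : (Fin d → ℝ) → β)
    (hF : ∀ x y, galC d n x = galC d n y → F x = F y) : Measurable F := by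
  have h : Function.FactorsThrough F (galC d n) := fun x y hxy => hF x y hxy
  by_cases hne : Nonempty β
  · obtain ⟨b⟩ := hne
    have : F = (Function.extend (galC d n) F (fun _ => b)) ∘ galC d n := by
      funext x
      exact (h.extend_apply _ x).symm
    rw [this]
    exact (measurable_of_countable _).comp (galC_measurable d n)
  · intro s _
    have : s = ∅ := by
      ext b; exact (hne ⟨b⟩).elim
    simp [this]

lemma gal_factor {d n : ℕ} {F : (Fin d → ℝ) → ℝ}
    (hF : ∀ x y, galC d n x = galC d n y → F x = F y) : ∃ h : (Fin d → ℤ) → ℝ, F = h ∘ galC d n := by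
  have h : Function.FactorsThrough F (galC d n) := fun x y hxy => hF x y hxy
  exact ⟨Function.extend (galC d n) F (fun _ => 0), by funext x; exact (h.extend_apply _ x).symm⟩

lemma gal_avg_congr {d n : ℕ} (hn : 1 ≤ n) (ψ : (Fin d → ℝ) → ℝ) {x y : Fin d → ℝ}
    (h : galC d n x = galC d n y) : cellAvg d n ψ x = cellAvg d n ψ y := by
  unfold cellAvg; rw [gal_cell_congr hn h]

lemma gal_avg_bound {d n : ℕ} (hn : 1 ≤ n) {ψ : (Fin d → ℝ) → ℝ}
    (hψ : Integrable ψ (cubeMeasure d)) {x : Fin d → ℝ} (hx : x ∈ galU d) :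
    |cellAvg d n ψ x| ≤ (n:ℝ) ^ d * ∫ y, |ψ y| ∂cubeMeasure d := by
  unfold cellAvg
  rw [abs_mul, abs_of_nonneg (by positivity : (0:ℝ) ≤ (n:ℝ) ^ d)]
  refine mul_le_mul_of_nonneg_left ?_ (by positivity)
  refine (MeasureTheory.abs_integral_le_integral_abs).trans ?_
  rw [gal_cube_eq] at hψ ⊢
  exact setIntegral_mono_set hψ.abs (Filter.Eventually.of_forall fun _ => abs_nonneg _)
    (gal_cell_subset hn hx).eventuallyLE

lemma gal_avg_mul {d n : ℕ} (hn : 1 ≤ n) {ψ : (Fin d → ℝ) → ℝ}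
    (hψ : Integrable ψ (cubeMeasure d)) (h : (Fin d → ℤ) → ℝ) (A : ℝ) (hA : ∀ i, |h i| ≤ A) :
    ∫ y, cellAvg d n ψ y * h (galC d n y) ∂cubeMeasure d =
      ∫ y, ψ y * h (galC d n y) ∂cubeMeasure d := by
  have hhm : Measurable (fun y => h (galC d n y)) :=
    (measurable_of_countable h).comp (galC_measurable d n)
  have hi2 : Integrable (fun y => ψ y * h (galC d n y)) (cubeMeasure d) :=
    hψ.mul_bdd (c := A) hhm.aestronglyMeasurable (Filter.Eventually.of_forall fun y => hA _)
  have havg : Measurable (cellAvg d n ψ) := 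
    gal_meas_of_idx (n := n) _ fun x y hxy => gal_avg_congr hn ψ hxy
  have hi0 : Integrable (cellAvg d n ψ) (cubeMeasure d) := by
    refine Integrable.of_bound havg.aestronglyMeasurable
      ((n:ℝ) ^ d * ∫ y, |ψ y| ∂cubeMeasure d) ?_
    filter_upwards [gal_ae_mem d] with x hx
    exact gal_avg_bound hn hψ hx
  have hi1 : Integrable (fun y => cellAvg d n ψ y * h (galC d n y)) (cubeMeasure d) :=
    hi0.mul_bdd (c := A) hhm.aestronglyMeasurable (Filter.Eventually.of_forall fun y => hA _)
  have hU : galU d = ⋃ i : Fin d → ℤ, galC d n ⁻¹' {i} ∩ galU d := by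
    ext x; simp
  have hmeas : ∀ i : Fin d → ℤ, MeasurableSet (galC d n ⁻¹' {i} ∩ galU d) := fun i =>
    (galC_measurable d n (measurableSet_singleton i)).inter (galU_measurable d)
  have hdisj : Pairwise (Function.onFun Disjoint fun i : Fin d → ℤ => galC d n ⁻¹' {i} ∩ galU d) := by
    intro i j hij
    refine Set.disjoint_left.2 fun x hx hx' => hij ?_
    exact (hx.1 : galC d n x = i).symm.trans hx'.1
  rw [gal_cube_eq] at hi1 hi2 ⊢
  rw [hU, integral_iUnion hmeas hdisj (by rw [← hU]; exact hi1),
    integral_iUnion hmeas hdisj (by rw [← hU]; exact hi2)]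
  congr 1
  funext i
  rcases Set.eq_empty_or_nonempty (galC d n ⁻¹' {i} ∩ galU d) with he | ⟨x, hx, hxU⟩
  · rw [he]; simp
  · have hc : galC d n ⁻¹' {i} ∩ galU d = cellOf d n x := by
      rw [← (hx : galC d n x = i), ← gal_cell_eq hn]
      exact Set.inter_eq_left.2 (gal_cell_subset hn hxU)
    rw [hc]
    have e1 : ∫ y in cellOf d n x, cellAvg d n ψ y * h (galC d n y) =
        ∫ y in cellOf d n x, cellAvg d n ψ x * h (galC d n x) := by
      refine setIntegral_congr_fun (gal_cell_meas hn x) fun y hy => ?_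
      rw [gal_cell_eq hn] at hy
      have hy' : galC d n y = galC d n x := hy
      rw [gal_avg_congr hn ψ hy', hy']
    have e2 : ∫ y in cellOf d n x, ψ y * h (galC d n y) =
        ∫ y in cellOf d n x, ψ y * h (galC d n x) := by
      refine setIntegral_congr_fun (gal_cell_meas hn x) fun y hy => ?_
      rw [gal_cell_eq hn] at hy
      have hy' : galC d n y = galC d n x := hy
      rw [hy']
    rw [e1, e2, setIntegral_const, MeasureTheory.integral_mul_const, smul_eq_mul]
    unfold cellAvg
    linear_combination ((∫ z in cellOf d n x, ψ z) * h (galC d n x)) * gal_cell_vol hn x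

lemma gal_K_int {d : ℕ} {K : (Fin d → ℝ) → (Fin d → ℝ) → ℝ} 
    (hK : Integrable (Function.uncurry K) ((cubeMeasure d).prod (cubeMeasure d)))
    {A B : Set (Fin d → ℝ)} (hA : A ⊆ galU d) (hB : B ⊆ galU d) :
    Integrable (Function.uncurry K) ((volume.restrict A).prod (volume.restrict B)) := by
  rw [gal_cube_eq, Measure.prod_restrict] at hK
  rw [Measure.prod_restrict]
  exact hK.mono_measure (Measure.restrict_mono (Set.prod_mono hA hB) le_rfl)

lemma gal_fst_int {d n : ℕ} (hn : 1 ≤ n) {K : (Fin d → ℝ) → (Fin d → ℝ) → ℝ} 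
    (hK : Integrable (Function.uncurry K) ((cubeMeasure d).prod (cubeMeasure d)))
    {x : Fin d → ℝ} (hx : x ∈ galU d) : Integrable (cellAvgFst d n K x) (cubeMeasure d) := by
  unfold cellAvgFst
  rw [gal_cube_eq]
  exact (gal_K_int hK (gal_cell_subset hn hx) le_rfl).integral_prod_right.const_mul _

lemma gal_ker_eq {d n : ℕ} (hn : 1 ≤ n) {K : (Fin d → ℝ) → (Fin d → ℝ) → ℝ} 
    (hK : Integrable (Function.uncurry K) ((cubeMeasure d).prod (cubeMeasure d)))
    {x y : Fin d → ℝ} (hx : x ∈ galU d) (hy : y ∈ galU d) :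
    cellAvgKer d n K x y = cellAvg d n (cellAvgFst d n K x) y := by
  unfold cellAvgKer cellAvg cellAvgFst
  rw [integral_integral_swap (gal_K_int hK (gal_cell_subset hn hx) (gal_cell_subset hn hy)),
    MeasureTheory.integral_const_mul]

lemma gal_ker_mul {d n : ℕ} (hn : 1 ≤ n) {K : (Fin d → ℝ) → (Fin d → ℝ) → ℝ} 
    (hK : Integrable (Function.uncurry K) ((cubeMeasure d).prod (cubeMeasure d)))
    {x : Fin d → ℝ} (hx : x ∈ galU d) (h : (Fin d → ℤ) → ℝ) (A : ℝ) (hA : ∀ i, |h i| ≤ A) :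
    ∫ y, cellAvgKer d n K x y * h (galC d n y) ∂cubeMeasure d =
      ∫ y, cellAvgFst d n K x y * h (galC d n y) ∂cubeMeasure d := by
  rw [← gal_avg_mul hn (gal_fst_int hn hK hx) h A hA]
  apply MeasureTheory.integral_congr_ae
  filter_upwards [gal_ae_mem d] with y hy
  rw [gal_ker_eq hn hK hx hy]

lemma gal_ker_bound {d n : ℕ} (hn : 1 ≤ n) {K : (Fin d → ℝ) → (Fin d → ℝ) → ℝ} 
    (hK : Integrable (Function.uncurry K) ((cubeMeasure d).prod (cubeMeasure d))) :
    ∃ C : ℝ, ∀ x ∈ galU d, ∀ y ∈ galU d, |cellAvgKer d n K x y| ≤ C := by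
  refine ⟨(n:ℝ) ^ d * ((n:ℝ) ^ d * 
    ∫ p, |Function.uncurry K p| ∂((cubeMeasure d).prod (cubeMeasure d))), fun x hx y hy => ?_⟩
  have h0 : (0:ℝ) ≤ (n:ℝ) ^ d := by positivity
  unfold cellAvgKer
  rw [abs_mul, abs_mul, abs_of_nonneg h0]
  refine mul_le_mul_of_nonneg_left (mul_le_mul_of_nonneg_left ?_ h0) h0
  rw [integral_integral (gal_K_int hK (gal_cell_subset hn hx) (gal_cell_subset hn hy))]
  refine (MeasureTheory.abs_integral_le_integral_abs).trans ?_
  rw [gal_cube_eq, Measure.prod_restrict] at hK ⊢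
  rw [Measure.prod_restrict]
  exact setIntegral_mono_set hK.abs (Filter.Eventually.of_forall fun _ => abs_nonneg _)
    (Set.prod_mono (gal_cell_subset hn hx) (gal_cell_subset hn hy)).eventuallyLE

lemma gal_ker_meas {d n : ℕ} (hn : 1 ≤ n) (K : (Fin d → ℝ) → (Fin d → ℝ) → ℝ) :
    Measurable (Function.uncurry (cellAvgKer d n K)) := by
  let F : (Fin d → ℤ) × (Fin d → ℤ) → ℝ := fun p =>
    (n : ℝ) ^ d * ((n : ℝ) ^ d * ∫ z in galC d n ⁻¹' {p.1}, ∫ z' in galC d n ⁻¹' {p.2}, K z z')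
  have : Function.uncurry (cellAvgKer d n K) = F ∘ (Prod.map (galC d n) (galC d n)) := by
    funext p
    simp only [Function.uncurry, cellAvgKer, F, gal_cell_eq hn, Function.comp, Prod.map]
  rw [this]
  exact (measurable_of_countable F).comp ((galC_measurable d n).prodMap (galC_measurable d n))

lemma gal_fst_meas {d n : ℕ} (hn : 1 ≤ n) {K : (Fin d → ℝ) → (Fin d → ℝ) → ℝ}
    (hK : Measurable (Function.uncurry K)) :
    Measurable (Function.uncurry (cellAvgFst d n K)) := by
  let F : (Fin d → ℤ) × (Fin d → ℝ) → ℝ := fun p =>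
    (n : ℝ) ^ d * ∫ z in galC d n ⁻¹' {p.1}, K z p.2
  have : Function.uncurry (cellAvgFst d n K) = F ∘ (Prod.map (galC d n) id) := by
    funext p
    simp only [Function.uncurry, cellAvgFst, F, gal_cell_eq hn, Function.comp, Prod.map, id]
  rw [this]
  have hF : Measurable F := by
    refine measurable_from_prod_countable_right fun i => ?_
    have : StronglyMeasurable (fun y => ∫ z in galC d n ⁻¹' {i}, Function.uncurry K (z, y)) :=
      hK.stronglyMeasurable.integral_prod_left'
    exact this.measurable.const_mul _
  exact hF.comp ((galC_measurable d n).prodMap measurable_id)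

lemma gal_fst_bound {d n : ℕ} (hn : 1 ≤ n) {K : (Fin d → ℝ) → (Fin d → ℝ) → ℝ}
    (hK : Measurable (Function.uncurry K)) {K₂ : ℝ} {y : Fin d → ℝ}
    (hy : Integrable (fun x => (K x y) ^ 2) (cubeMeasure d) ∧
        (∫ x, (K x y) ^ 2 ∂cubeMeasure d) ≤ K₂) {x : Fin d → ℝ} (hx : x ∈ galU d) :
    |cellAvgFst d n K x y| ≤ (n:ℝ) ^ d * (1 + K₂) := by
  have hKy : Measurable (fun x => K x y) := hK.comp measurable_prodMk_right
  have hm : MemLp (fun x => K x y) 2 (cubeMeasure d) :=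
    (memLp_two_iff_integrable_sq hKy.aestronglyMeasurable).2 hy.1
  have hi : Integrable (fun x => K x y) (cubeMeasure d) := hm.integrable (by norm_num)
  refine (gal_avg_bound hn hi hx).trans ?_
  refine mul_le_mul_of_nonneg_left ?_ (by positivity)
  calc _ ≤ ∫ x, (1 + (K x y) ^ 2) ∂cubeMeasure d := by
        refine integral_mono hi.abs ((integrable_const 1).add hy.1) fun x => ?_
        have := sq_abs (K x y)
        simp only
        nlinarith [abs_nonneg (K x y), sq_nonneg (|K x y| - 1)]
    _ = 1 + ∫ x, (K x y) ^ 2 ∂cubeMeasure d := by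
        rw [MeasureTheory.integral_add (integrable_const 1) hy.1]; simp
    _ ≤ _ := by linarith [hy.2]

lemma gal_diff_int {d n : ℕ} (hn : 1 ≤ n) {K : (Fin d → ℝ) → (Fin d → ℝ) → ℝ}
    (hK : Measurable (Function.uncurry K)) {K₂ : ℝ}
    (hK2 : ∀ᵐ y ∂cubeMeasure d,
      Integrable (fun x => (K x y) ^ 2) (cubeMeasure d) ∧
        (∫ x, (K x y) ^ 2 ∂cubeMeasure d) ≤ K₂) :
    Integrable (fun p : (Fin d → ℝ) × (Fin d → ℝ) => (K p.1 p.2 - cellAvgFst d n K p.1 p.2) ^ 2)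
      ((cubeMeasure d).prod (cubeMeasure d)) := by
  have hm : Measurable (fun p : (Fin d → ℝ) × (Fin d → ℝ) =>
      (K p.1 p.2 - cellAvgFst d n K p.1 p.2) ^ 2) :=
    (hK.sub (gal_fst_meas hn hK)).pow_const 2
  set C := (n:ℝ) ^ d * (1 + K₂) with hC
  have hb : ∀ᵐ y ∂cubeMeasure d, Integrable (fun x => (K x y) ^ 2) (cubeMeasure d) ∧
        (∫ x, (K x y) ^ 2 ∂cubeMeasure d) ≤ K₂ ∧ 
      ∀ᵐ x ∂cubeMeasure d, (K x y - cellAvgFst d n K x y) ^ 2 ≤ 2 * K x y ^ 2 + 2 * C ^ 2 := by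
    filter_upwards [hK2] with y hy
    refine ⟨hy.1, hy.2, ?_⟩
    filter_upwards [gal_ae_mem d] with x hx
    have h1 := gal_fst_bound hn hK hy hx
    have h2 : cellAvgFst d n K x y ^ 2 ≤ C ^ 2 := by
      rw [← sq_abs]; exact pow_le_pow_left₀ (abs_nonneg _) h1 2
    nlinarith [sq_nonneg (K x y + cellAvgFst d n K x y)]
  have hb' : ∀ᵐ y ∂cubeMeasure d, 
      Integrable (fun x => (K x y - cellAvgFst d n K x y) ^ 2) (cubeMeasure d) ∧ 
      ∫ x, (K x y - cellAvgFst d n K x y) ^ 2 ∂cubeMeasure d ≤ 2 * K₂ + 2 * C ^ 2 := by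
    filter_upwards [hb] with y hy
    have hi : Integrable (fun x => 2 * K x y ^ 2 + 2 * C ^ 2) (cubeMeasure d) :=
      (hy.1.const_mul 2).add (integrable_const _)
    have hii : Integrable (fun x => (K x y - cellAvgFst d n K x y) ^ 2) (cubeMeasure d) := by
      refine hi.mono' (hm.comp measurable_prodMk_right).aestronglyMeasurable ?_
      filter_upwards [hy.2.2] with x hx
      rw [Real.norm_eq_abs, abs_of_nonneg (sq_nonneg _)]
      exact hx
    refine ⟨hii, (MeasureTheory.integral_mono_ae hii hi hy.2.2).trans ?_⟩
    rw [MeasureTheory.integral_add (hy.1.const_mul 2) (integrable_const _),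
      MeasureTheory.integral_const_mul]
    simp
    exact hy.2.1
  rw [integrable_prod_iff' hm.aestronglyMeasurable]
  refine ⟨hb'.mono fun y hy => hy.1, ?_⟩
  refine (integrable_const (2 * K₂ + 2 * C ^ 2)).mono'
    hm.aestronglyMeasurable.norm.prod_swap.integral_prod_right' ?_
  filter_upwards [hb'] with y hy
  simp only [norm_pow, Real.norm_eq_abs, sq_abs]
  rw [abs_of_nonneg (integral_nonneg fun _ => sq_nonneg _)]
  exact hy.2

lemma gal_K_integrable {d : ℕ} {K : (Fin d → ℝ) → (Fin d → ℝ) → ℝ}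
    (hK : Measurable (Function.uncurry K)) {K₂ : ℝ}
    (hK2 : ∀ᵐ y ∂cubeMeasure d,
      Integrable (fun x => (K x y) ^ 2) (cubeMeasure d) ∧
        (∫ x, (K x y) ^ 2 ∂cubeMeasure d) ≤ K₂) :
    Integrable (Function.uncurry K) ((cubeMeasure d).prod (cubeMeasure d)) := by
  have hsq : Integrable (fun p => Function.uncurry K p ^ 2)
      ((cubeMeasure d).prod (cubeMeasure d)) := by
    rw [integrable_prod_iff' (hK.pow_const 2).aestronglyMeasurable]
    refine ⟨hK2.mono fun y hy => hy.1, ?_⟩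
    refine (integrable_const K₂).mono'
      (hK.pow_const 2).aestronglyMeasurable.norm.prod_swap.integral_prod_right' ?_
    filter_upwards [hK2] with y hy
    simp only [norm_pow, Real.norm_eq_abs, sq_abs, Function.uncurry]
    rw [abs_of_nonneg (integral_nonneg fun _ => sq_nonneg _)]
    exact hy.2
  exact ((memLp_two_iff_integrable_sq hK.aestronglyMeasurable).2 hsq).integrable (by norm_num)

/-- Consistency error on cell-constant functions. -/
lemma gal_consist {d n : ℕ} (hn : 1 ≤ n) {K : (Fin d → ℝ) → (Fin d → ℝ) → ℝ}
    (hK : Measurable (Function.uncurry K)) {K₁ K₂ : ℝ}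
    (hK1 : ∀ᵐ x ∂cubeMeasure d,
      Integrable (fun y => (K x y) ^ 2) (cubeMeasure d) ∧
        (∫ y, (K x y) ^ 2 ∂cubeMeasure d) ≤ K₁)
    (hK2 : ∀ᵐ y ∂cubeMeasure d,
      Integrable (fun x => (K x y) ^ 2) (cubeMeasure d) ∧
        (∫ x, (K x y) ^ 2 ∂cubeMeasure d) ≤ K₂)
    (S : ℝ → ℝ → ℝ) (hS : Continuous (Function.uncurry S))
    (A_S : ℝ) (hAS : 0 ≤ A_S) (hSbound : ∀ a b : ℝ, |S a b| ≤ A_S)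
    (φ : ℝ → ℝ) (v D D' : Lp ℝ 2 (cubeMeasure d)) (h : (Fin d → ℤ) → ℝ)
    (hv : v =ᵐ[cubeMeasure d] h ∘ galC d n)
    (hD : D =ᵐ[cubeMeasure d] fun x => φ (v x) + ∫ y, K x y * S (v x) (v y) ∂cubeMeasure d)
    (hD' : D' =ᵐ[cubeMeasure d]
      fun x => φ (v x) + ∫ y, cellAvgKer d n K x y * S (v x) (v y) ∂cubeMeasure d) :
    ‖D - D'‖ ≤ A_S * Real.sqrt
            (∫ x, ∫ y, (K x y - cellAvgFst d n K x y) ^ 2 ∂cubeMeasure d ∂cubeMeasure d) := by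
  have hKi := gal_K_integrable hK hK2
  have hdi := gal_diff_int hn hK hK2
  have hpt : ∀ᵐ x ∂cubeMeasure d, ((D - D' : Lp ℝ 2 (cubeMeasure d)) x) ^ 2 ≤
      A_S ^ 2 * ∫ y, (K x y - cellAvgFst d n K x y) ^ 2 ∂cubeMeasure d := by
    filter_upwards [Lp.coeFn_sub D D', hD, hD', gal_ae_mem d, hK1, hdi.prod_right_ae]
      with x h1 h2 h3 hx h5 h6
    have hMx : Measurable (K x) := hK.comp measurable_prodMk_left
    have hMm : MemLp (K x) 2 (cubeMeasure d) :=
      (memLp_two_iff_integrable_sq hMx.aestronglyMeasurable).2 h5.1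
    have hMi : Integrable (K x) (cubeMeasure d) := hMm.integrable (by norm_num)
    have hFi := gal_fst_int hn hKi hx
    have hSm : AEStronglyMeasurable (fun y => S (v x) (v y)) (cubeMeasure d) :=
      (hS.comp (continuous_const.prodMk continuous_id) :
        Continuous (fun b => S (v x) b)).comp_aestronglyMeasurable (Lp.aestronglyMeasurable v)
    have hval : (D - D' : Lp ℝ 2 (cubeMeasure d)) x =
        ∫ y, (K x y - cellAvgFst d n K x y) * S (v x) (v y) ∂cubeMeasure d := by
      have e : ∫ y, cellAvgKer d n K x y * S (v x) (v y) ∂cubeMeasure d =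
          ∫ y, cellAvgFst d n K x y * S (v x) (v y) ∂cubeMeasure d := by
        have := gal_ker_mul hn hKi hx (fun i => S (v x) (h i)) A_S (fun i => hSbound _ _)
        have e1 : ∀ M : (Fin d → ℝ) → ℝ, ∫ y, M y * S (v x) (v y) ∂cubeMeasure d =
            ∫ y, M y * S (v x) (h (galC d n y)) ∂cubeMeasure d := fun M => by
          apply MeasureTheory.integral_congr_ae
          filter_upwards [hv] with y hy
          rw [hy]; rfl
        rw [e1, e1, this]
      rw [h1, Pi.sub_apply, h2, h3, e]
      simp only [sub_mul]
      rw [MeasureTheory.integral_sub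
        (hMi.mul_bdd (c := A_S) hSm (Filter.Eventually.of_forall fun y => hSbound _ _))
        (hFi.mul_bdd (c := A_S) hSm (Filter.Eventually.of_forall fun y => hSbound _ _))]
      ring
    have hmeas : AEStronglyMeasurable
        (fun y => (K x y - cellAvgFst d n K x y) * S (v x) (v y)) (cubeMeasure d) :=
      (hMx.aestronglyMeasurable.sub hFi.aestronglyMeasurable).mul hSm
    have hple : ∀ y, ((K x y - cellAvgFst d n K x y) * S (v x) (v y)) ^ 2 ≤
        A_S ^ 2 * (K x y - cellAvgFst d n K x y) ^ 2 := fun y => by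
      rw [mul_pow, mul_comm]
      refine mul_le_mul_of_nonneg_right ?_ (sq_nonneg _)
      rw [← sq_abs]
      exact pow_le_pow_left₀ (abs_nonneg _) (hSbound _ _) 2
    have hb := h6.const_mul (A_S ^ 2)
    have hint : Integrable
        (fun y => ((K x y - cellAvgFst d n K x y) * S (v x) (v y)) ^ 2) (cubeMeasure d) := by
      refine hb.mono' (hmeas.pow 2) (Filter.Eventually.of_forall fun y => ?_)
      rw [Real.norm_eq_abs, abs_of_nonneg (sq_nonneg _)]
      exact hple y
    rw [hval, ← MeasureTheory.integral_const_mul]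
    exact (gal_jensen hmeas hint).trans (integral_mono hint hb hple)
  have hsq : ‖D - D'‖ ^ 2 ≤ A_S ^ 2 *
      ∫ x, ∫ y, (K x y - cellAvgFst d n K x y) ^ 2 ∂cubeMeasure d ∂cubeMeasure d := by
    rw [gal_norm_sq, ← MeasureTheory.integral_const_mul]
    exact MeasureTheory.integral_mono_ae (gal_sq_integrable _)
      (hdi.integral_prod_left.const_mul _) hpt
  have := Real.le_sqrt_of_sq_le hsq
  rwa [Real.sqrt_mul (sq_nonneg _), Real.sqrt_sq hAS] at this

/-- The subspace of cell-constant functions. -/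
def galV (d n : ℕ) : Submodule ℝ (Lp ℝ 2 (cubeMeasure d)) :=
  lpMeas ℝ ℝ (MeasurableSpace.comap (galC d n) inferInstance) 2 (cubeMeasure d)

instance galV_proj (d n : ℕ) : (galV d n).HasOrthogonalProjection := by
  have : Fact (MeasurableSpace.comap (galC d n) inferInstance ≤ MeasurableSpace.pi) :=
    ⟨(galC_measurable d n).comap_le⟩
  unfold galV
  infer_instance

lemma galV_mem {d n : ℕ} {v : Lp ℝ 2 (cubeMeasure d)} :
    v ∈ galV d n ↔ ∃ h : (Fin d → ℤ) → ℝ, v =ᵐ[cubeMeasure d] h ∘ galC d n := by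
  rw [galV, mem_lpMeas_iff_aestronglyMeasurable]
  constructor
  · rintro ⟨v', hv', hvv'⟩
    obtain ⟨h, _, hh⟩ := hv'.exists_eq_measurable_comp
    exact ⟨h, by rw [← hh]; exact hvv'⟩
  · rintro ⟨h, hh⟩
    refine ⟨h ∘ galC d n, ?_, hh⟩
    exact Measurable.stronglyMeasurable
      ((measurable_of_countable h).comp (comap_measurable (galC d n)))

lemma galV_mem_of {d n : ℕ} {v : Lp ℝ 2 (cubeMeasure d)} {F : (Fin d → ℝ) → ℝ}
    (hv : v =ᵐ[cubeMeasure d] F) (hF : ∀ x y, galC d n x = galC d n y → F x = F y) :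
    v ∈ galV d n := by
  obtain ⟨h, rfl⟩ := gal_factor hF
  exact galV_mem.2 ⟨h, hv⟩

lemma gal_sqrt_eq {d : ℕ} {n : ℕ} (v vN : Lp ℝ 2 (cubeMeasure d))
    (h : vN =ᵐ[cubeMeasure d] cellAvg d n v) :
    Real.sqrt (∫ x, (v x - cellAvg d n v x) ^ 2 ∂cubeMeasure d) = ‖v - vN‖ := by
  rw [← Real.sqrt_sq (norm_nonneg (v - vN)), gal_norm_sq]
  congr 1
  apply MeasureTheory.integral_congr_ae
  filter_upwards [h, Lp.coeFn_sub v vN] with x h1 h2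
  rw [h2, Pi.sub_apply, h1]

/-- pathwise Galerkin error bound.  With `u` the continuum solution and `u^n`
the solution of the cell-average-projected problem,
`sup_{t∈[0,T]} ‖u(t) − uⁿ(t)‖ ≤ e^{(√(2(K₁+K₂)) L_S + L_f)T}
  (‖g − P_n g‖ + T A_S ‖K − P_n^{(1)}K‖ + sup_{t∈[0,T]} ‖w(t) − P_n w(t)‖)`. -/
theorem galerkin_error_bound
    (d : ℕ) (hd : 1 ≤ d) (T : ℝ) (hT : 0 < T) (n : ℕ) (hn : 1 ≤ n)
    (K : (Fin d → ℝ) → (Fin d → ℝ) → ℝ) (hKmeas : Measurable (Function.uncurry K))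
    (K₁ K₂ : ℝ)
    (hK1 : ∀ᵐ x ∂cubeMeasure d,
      Integrable (fun y => (K x y) ^ 2) (cubeMeasure d) ∧
        (∫ y, (K x y) ^ 2 ∂cubeMeasure d) ≤ K₁)
    (hK2 : ∀ᵐ y ∂cubeMeasure d,
      Integrable (fun x => (K x y) ^ 2) (cubeMeasure d) ∧
        (∫ x, (K x y) ^ 2 ∂cubeMeasure d) ≤ K₂)
    (S : ℝ → ℝ → ℝ)
    (A_S L_S : ℝ) (hAS : 0 ≤ A_S) (hLS : 0 ≤ L_S)
    (hSbound : ∀ a b : ℝ, |S a b| ≤ A_S)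
    (hSlip : ∀ a b a' b' : ℝ, |S a b - S a' b'| ≤ L_S * (|a - a'| + |b - b'|))
    (f : ℝ → ℝ → ℝ) (hfcont : Continuous (Function.uncurry f))
    (A_f B_f L_f : ℝ) (hAf : 0 ≤ A_f) (hBf : 0 ≤ B_f) (hLf : 0 ≤ L_f)
    (hfbound : ∀ t ∈ Set.Icc (0:ℝ) T, ∀ v : ℝ, |f t v| ≤ A_f + B_f * |v|)
    (hflip : ∀ t ∈ Set.Icc (0:ℝ) T, ∀ v v' : ℝ, |f t v - f t v'| ≤ L_f * |v - v'|)
    (g : Lp ℝ 2 (cubeMeasure d)) (w : ℝ → Lp ℝ 2 (cubeMeasure d)) (hw : Continuous w)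
    -- the projected data, characterized almost everywhere
    (gN : Lp ℝ 2 (cubeMeasure d))
    (hgN : (gN : (Fin d → ℝ) → ℝ) =ᵐ[cubeMeasure d] cellAvg d n g)
    (wN : ℝ → Lp ℝ 2 (cubeMeasure d))
    (hwN : ∀ t ∈ Set.Icc (0:ℝ) T,
      (wN t : (Fin d → ℝ) → ℝ) =ᵐ[cubeMeasure d] cellAvg d n (w t))
    -- the continuum and projected drift operators, characterized almost everywhere
    (N : ℝ → Lp ℝ 2 (cubeMeasure d) → Lp ℝ 2 (cubeMeasure d))
    (hN : ∀ s ∈ Set.Icc (0:ℝ) T, ∀ v : Lp ℝ 2 (cubeMeasure d),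
      (N s v : (Fin d → ℝ) → ℝ) =ᵐ[cubeMeasure d]
        fun x => f s (v x) + ∫ y, K x y * S (v x) (v y) ∂cubeMeasure d)
    (Nn : ℝ → Lp ℝ 2 (cubeMeasure d) → Lp ℝ 2 (cubeMeasure d))
    (hNn : ∀ s ∈ Set.Icc (0:ℝ) T, ∀ v : Lp ℝ 2 (cubeMeasure d),
      (Nn s v : (Fin d → ℝ) → ℝ) =ᵐ[cubeMeasure d]
        fun x => f s (v x) + ∫ y, cellAvgKer d n K x y * S (v x) (v y) ∂cubeMeasure d)
    -- the solutions
    (u : ℝ → Lp ℝ 2 (cubeMeasure d)) (hu_cont : ContinuousOn u (Set.Icc 0 T))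
    (hu : ∀ t ∈ Set.Icc (0:ℝ) T, u t = g + (∫ s in (0:ℝ)..t, N s (u s)) + w t)
    (uN : ℝ → Lp ℝ 2 (cubeMeasure d)) (huN_cont : ContinuousOn uN (Set.Icc 0 T))
    (huN : ∀ t ∈ Set.Icc (0:ℝ) T, uN t = gN + (∫ s in (0:ℝ)..t, Nn s (uN s)) + wN t) :
    (⨆ t : Set.Icc (0:ℝ) T, ‖u t - uN t‖) ≤
      Real.exp ((Real.sqrt (2 * (K₁ + K₂)) * L_S + L_f) * T) *
        (Real.sqrt (∫ x, ((g : (Fin d → ℝ) → ℝ) x - cellAvg d n g x) ^ 2 ∂cubeMeasure d) +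
          T * A_S * Real.sqrt
            (∫ x, ∫ y, (K x y - cellAvgFst d n K x y) ^ 2 ∂cubeMeasure d ∂cubeMeasure d) +
          ⨆ t : Set.Icc (0:ℝ) T, Real.sqrt
            (∫ x, ((w t : (Fin d → ℝ) → ℝ) x - cellAvg d n (w t) x) ^ 2 ∂cubeMeasure d)) := by
  have hSc : Continuous (Function.uncurry S) := by
    rw [continuous_iff_continuousAt]
    rintro ⟨a, b⟩
    refine tendsto_iff_norm_sub_tendsto_zero.2 ?_
    have hlim : Filter.Tendsto (fun p : ℝ × ℝ => L_S * (|p.1 - a| + |p.2 - b|))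
        (nhds (a, b)) (nhds 0) := by
      have : Continuous (fun p : ℝ × ℝ => L_S * (|p.1 - a| + |p.2 - b|)) := by fun_prop
      simpa using this.tendsto (a, b)
    exact squeeze_zero (fun _ => norm_nonneg _) (fun p => hSlip p.1 p.2 a b) hlim
  have hfs : ∀ s, Continuous (f s) := fun s =>
    hfcont.comp (continuous_const.prodMk continuous_id)
  have hKi := gal_K_integrable hKmeas hK2
  have hkm := gal_ker_meas hn K
  set L := Real.sqrt (2 * (K₁ + K₂)) * L_S + L_f with hL
  have hL0 : 0 ≤ L := by positivity
  -- Lipschitz bounds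
  have hNL : ∀ s ∈ Set.Icc (0:ℝ) T, ∀ v v', ‖N s v - N s v'‖ ≤ L * ‖v - v'‖ := fun s hs v v' =>
    gal_lip K hKmeas K₁ K₂ hK1 hK2 S hSc A_S L_S hLS hSbound hSlip (f s) (hfs s) L_f
      (hflip s hs) v v' _ _ (hN s hs v) (hN s hs v')
  obtain ⟨C, hC⟩ := gal_ker_bound hn hKi
  have hsqb : ∀ x ∈ galU d, ∀ y ∈ galU d, cellAvgKer d n K x y ^ 2 ≤ C ^ 2 := fun x hx y hy => by
    rw [← sq_abs]; exact pow_le_pow_left₀ (abs_nonneg _) (hC x hx y hy) 2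
  have hrow : ∀ F : (Fin d → ℝ) → ℝ, Measurable F → (∀ y ∈ galU d, F y ^ 2 ≤ C ^ 2) →
      Integrable (fun y => F y ^ 2) (cubeMeasure d) ∧
        ∫ y, F y ^ 2 ∂cubeMeasure d ≤ C ^ 2 := fun F hF hb => by
    have hae : ∀ᵐ y ∂cubeMeasure d, F y ^ 2 ≤ C ^ 2 := (gal_ae_mem d).mono hb
    have hi : Integrable (fun y => F y ^ 2) (cubeMeasure d) := by
      refine Integrable.of_bound (hF.pow_const 2).aestronglyMeasurable (C ^ 2) ?_
      filter_upwards [hae] with y hy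
      rw [Real.norm_eq_abs, abs_of_nonneg (sq_nonneg _)]
      exact hy
    refine ⟨hi, (MeasureTheory.integral_mono_ae hi (integrable_const _) hae).trans ?_⟩
    simp
  have hk1 : ∀ᵐ x ∂cubeMeasure d,
      Integrable (fun y => (cellAvgKer d n K x y) ^ 2) (cubeMeasure d) ∧
        (∫ y, (cellAvgKer d n K x y) ^ 2 ∂cubeMeasure d) ≤ C ^ 2 := by
    filter_upwards [gal_ae_mem d] with x hx
    exact hrow (fun y => cellAvgKer d n K x y) (Measurable.of_uncurry_left hkm) (hsqb x hx)
  have hk2 : ∀ᵐ y ∂cubeMeasure d,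
      Integrable (fun x => (cellAvgKer d n K x y) ^ 2) (cubeMeasure d) ∧
        (∫ x, (cellAvgKer d n K x y) ^ 2 ∂cubeMeasure d) ≤ C ^ 2 := by
    filter_upwards [gal_ae_mem d] with y hy
    exact hrow (fun x => cellAvgKer d n K x y) (Measurable.of_uncurry_right hkm)
      (fun x hx => hsqb x hx y hy)
  set L' := Real.sqrt (2 * (C ^ 2 + C ^ 2)) * L_S + L_f with hL'
  have hL0' : 0 ≤ L' := by positivity
  have hNnL : ∀ s ∈ Set.Icc (0:ℝ) T, ∀ v v', ‖Nn s v - Nn s v'‖ ≤ L' * ‖v - v'‖ :=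
    fun s hs v v' =>
    gal_lip (cellAvgKer d n K) hkm (C ^ 2) (C ^ 2) hk1 hk2 S hSc A_S L_S hLS hSbound hSlip
      (f s) (hfs s) L_f (hflip s hs) v v' _ _ (hNn s hs v) (hNn s hs v')
  have hNc : ContinuousOn (fun s => N s (u s)) (Set.Icc 0 T) :=
    gal_cont f hfcont hfbound N _ hN hNL u hu_cont
  have hNnc : ContinuousOn (fun s => Nn s (uN s)) (Set.Icc 0 T) :=
    gal_cont f hfcont hfbound Nn _ hNn hNnL uN huN_cont
  have hsub : ∀ t ∈ Set.Icc (0:ℝ) T, Set.uIcc 0 t ⊆ Set.Icc 0 T := fun t ht => by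
    rw [Set.uIcc_of_le ht.1]; exact Set.Icc_subset_Icc_right ht.2
  -- the projected solution is cell-constant
  have hmem : ∀ t ∈ Set.Icc (0:ℝ) T, uN t ∈ galV d n := by
    refine gal_mem_subspace (galV d n) hT.le hL0' Nn ?_ hNnL uN (fun t => gN + wN t) huN_cont hNnc
      ?_ ?_
    · intro s hs v hv
      obtain ⟨h, hh⟩ := galV_mem.1 hv
      refine galV_mem_of (F := fun x => f s (h (galC d n x)) +
        ∫ y, cellAvgKer d n K x y * S (h (galC d n x)) (v y) ∂cubeMeasure d) ?_ ?_
      · filter_upwards [hNn s hs v, hh] with x h1 h2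
        rw [h1, h2]; rfl
      · intro x y hxy
        have : ∀ z, cellAvgKer d n K x z = cellAvgKer d n K y z := fun z => by
          unfold cellAvgKer; rw [gal_cell_congr hn hxy]
        simp only [hxy, this]
    · intro t ht
      exact (galV d n).add_mem (galV_mem_of hgN fun x y => gal_avg_congr hn _)
        (galV_mem_of (hwN t ht) fun x y => gal_avg_congr hn _)
    · intro t ht
      rw [huN t ht]; abel
  -- rewriting the data errors as norms
  have hsupeq : (fun t : Set.Icc (0:ℝ) T => Real.sqrt
      (∫ x, ((w t : (Fin d → ℝ) → ℝ) x - cellAvg d n (w t) x) ^ 2 ∂cubeMeasure d)) =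
      fun t : Set.Icc (0:ℝ) T => ‖w t - wN t‖ := by
    funext t
    exact gal_sqrt_eq _ _ (hwN t t.2)
  rw [hsupeq, gal_sqrt_eq g gN hgN]
  have hbdd : BddAbove (Set.range fun t : Set.Icc (0:ℝ) T => ‖w t - wN t‖) := by
    have hic : ContinuousOn (fun t => ∫ s in (0:ℝ)..t, Nn s (uN s)) (Set.Icc 0 T) := by
      have hio : IntegrableOn (fun s => Nn s (uN s)) (Set.uIcc 0 T) volume := by
        rw [Set.uIcc_of_le hT.le]; exact hNnc.integrableOn_Icc
      have := intervalIntegral.continuousOn_primitive_interval hio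
      rwa [Set.uIcc_of_le hT.le] at this
    have hcn : ContinuousOn (fun t => ‖w t - (uN t - gN - ∫ s in (0:ℝ)..t, Nn s (uN s))‖)
        (Set.Icc 0 T) :=
      (hw.continuousOn.sub ((huN_cont.sub continuousOn_const).sub hic)).norm
    obtain ⟨B, hB⟩ := isCompact_Icc.bddAbove_image hcn
    refine ⟨B, ?_⟩
    rintro _ ⟨t, rfl⟩
    have := hB ⟨t, t.2, rfl⟩
    refine le_trans (le_of_eq ?_) this
    simp only
    congr 2
    rw [huN t t.2]; abel
  set W := ⨆ t : Set.Icc (0:ℝ) T, ‖w t - wN t‖ with hW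
  set κ := Real.sqrt
    (∫ x, ∫ y, (K x y - cellAvgFst d n K x y) ^ 2 ∂cubeMeasure d ∂cubeMeasure d) with hκ
  have hec : ContinuousOn (fun t => ‖u t - uN t‖) (Set.Icc 0 T) := (hu_cont.sub huN_cont).norm
  have hκ0 : 0 ≤ κ := Real.sqrt_nonneg _
  have key := gal_gronwall (C := ‖g - gN‖ + T * A_S * κ + W) hT.le hL0 hec (fun t ht => by
    have hi1 : IntervalIntegrable (fun s => N s (u s)) volume 0 t :=
      (hNc.mono (hsub t ht)).intervalIntegrable
    have hi2 : IntervalIntegrable (fun s => Nn s (uN s)) volume 0 t :=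
      (hNnc.mono (hsub t ht)).intervalIntegrable
    have hi3 : IntervalIntegrable (fun s => L * ‖u s - uN s‖) volume 0 t :=
      (ContinuousOn.mono (continuousOn_const.mul hec) (hsub t ht)).intervalIntegrable
    have hdec : u t - uN t = (g - gN) + (∫ s in (0:ℝ)..t, (N s (u s) - Nn s (uN s))) +
        (w t - wN t) := by
      rw [intervalIntegral.integral_sub hi1 hi2, hu t ht, huN t ht]; abel
    have hI : ‖∫ s in (0:ℝ)..t, (N s (u s) - Nn s (uN s))‖ ≤
        ∫ s in (0:ℝ)..t, (L * ‖u s - uN s‖ + A_S * κ) := by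
      apply intervalIntegral.norm_integral_le_of_norm_le ht.1
      · refine Filter.Eventually.of_forall fun s hs => ?_
        have hs' : s ∈ Set.Icc (0:ℝ) T := ⟨hs.1.le, hs.2.trans ht.2⟩
        obtain ⟨h, hh⟩ := galV_mem.1 (hmem s hs')
        have h1 := hNL s hs' (u s) (uN s)
        have h2 := gal_consist hn hKmeas hK1 hK2 S hSc A_S hAS hSbound (f s) (uN s) _ _ h hh
          (hN s hs' (uN s)) (hNn s hs' (uN s))
        calc ‖N s (u s) - Nn s (uN s)‖
            = ‖(N s (u s) - N s (uN s)) + (N s (uN s) - Nn s (uN s))‖ := by congr 1; abel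
          _ ≤ ‖N s (u s) - N s (uN s)‖ + ‖N s (uN s) - Nn s (uN s)‖ := norm_add_le _ _
          _ ≤ _ := add_le_add h1 h2
      · exact hi3.add intervalIntegrable_const
    rw [intervalIntegral.integral_add hi3 intervalIntegrable_const,
      intervalIntegral.integral_const, sub_zero, smul_eq_mul] at hI
    have hWt : ‖w t - wN t‖ ≤ W := le_ciSup hbdd ⟨t, ht⟩
    have hTt : t * (A_S * κ) ≤ T * (A_S * κ) :=
      mul_le_mul_of_nonneg_right ht.2 (mul_nonneg hAS hκ0)
    rw [hdec]
    have := norm_add₃_le (a := g - gN) (b := ∫ s in (0:ℝ)..t, (N s (u s) - Nn s (uN s)))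
      (c := w t - wN t)
    linarith)
  have : Nonempty (Set.Icc (0:ℝ) T) := ⟨⟨0, le_rfl, hT.le⟩⟩
  have hW0 : 0 ≤ W := Real.iSup_nonneg fun _ => norm_nonneg _
  refine ciSup_le fun t => ?_
  refine (key t t.2).trans ?_
  rw [mul_comm]
  refine mul_le_mul_of_nonneg_right ?_ (by positivity)
  exact Real.exp_le_exp.2 (mul_le_mul_of_nonneg_left t.2.2 hL0)
end
end

section
/- In addition to the hypotheses of the pathwise Galerkin error bound (S bounded by A_S and L_S-Lipschitz, f continuous with linear growth and Lipschitz in u, K with K₁, K₂ finite, g ∈ L²(I^d), w : [0,T] → L²(I^d) continuous, u and u^n the solutions of the continuum and cell-average-projected integral equations), assume there exist α, β ∈ (0,1] and Λ_g, Λ_K ≥ 0 such that for every h ∈ ℝ^d with 0 < |h| ≤ √d, ∫_{{x ∈ I^d : x+h ∈ I^d}} |g(x+h) − g(x)|² dx ≤ (Λ_g |h|^α)², and for every H ∈ ℝ^{2d} with 0 < |H| ≤ √(2d), ∫_{{z ∈ I^{2d} : z+H ∈ I^{2d}}} |K(z+H) − K(z)|² dz ≤ (Λ_K |H|^β)². Then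 there exists a constant C, independent of n and of w, such that for all integers n ≥ 1: sup_{t ∈ [0,T]} ‖u(t) − u^n(t)‖_{L²(I^d)} ≤ C · max{ n^{−α}, n^{−β}, sup_{t ∈ [0,T]} ‖w(t) − P_n w(t)‖_{L²(I^d)} }. -/
open MeasureTheory Set intervalIntegral

noncomputable section

/-- The Euclidean norm of `h ∈ ℝ^d`. -/
def euclNorm (d : ℕ) (h : Fin d → ℝ) : ℝ := Real.sqrt (∑ i, (h i) ^ 2)

open scoped ENNReal

lemma cs_lintegral {X : Type*} [MeasurableSpace X] (μ : Measure X) (F : X → ℝ≥0∞)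
    (hF : AEMeasurable F μ) : (∫⁻ x, F x ∂μ) ^ 2 ≤ μ univ * ∫⁻ x, F x ^ 2 ∂μ := by
  have h := ENNReal.lintegral_mul_le_Lp_mul_Lq μ Real.HolderConjugate.two_two (f := fun _ => 1) (g := F)
    aemeasurable_const hF
  simp only [Pi.mul_apply, one_mul, ENNReal.one_rpow, lintegral_const] at h
  have h2 := pow_le_pow_left' h 2
  refine h2.trans (le_of_eq ?_)
  rw [mul_pow, ← ENNReal.rpow_natCast, ← ENNReal.rpow_natCast, ← ENNReal.rpow_mul, ← ENNReal.rpow_mul]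
  norm_num

lemma shift_lintegral {X : Type*} [MeasurableSpace X] (μ : Measure X) (F : X → ℝ) (hF : MemLp F 2 μ) :
    ∫⁻ x, ‖F x‖ₑ ^ 2 ∂μ = ENNReal.ofReal (∫ x, F x ^ 2 ∂μ) := by
  rw [ofReal_integral_eq_lintegral_ofReal hF.integrable_sq (ae_of_all _ fun x => sq_nonneg _)]
  refine lintegral_congr fun x => ?_
  rw [← enorm_pow, Real.enorm_eq_ofReal (sq_nonneg _)]

lemma Lp_enorm_sq {X : Type*} [MeasurableSpace X] {μ : Measure X} (F : Lp ℝ 2 μ) :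
    ‖F‖ₑ ^ 2 = ∫⁻ x, ‖F x‖ₑ ^ 2 ∂μ := by
  have h := eLpNorm_nnreal_pow_eq_lintegral (f := (F : X → ℝ)) (μ := μ) (p := 2) (by norm_num)
  rw [Lp.enorm_def]
  norm_num at h
  exact_mod_cast h

lemma Lp_norm_le {X : Type*} [MeasurableSpace X] {μ : Measure X} (F : Lp ℝ 2 μ) (c : ℝ)
    (hc : 0 ≤ c) (h : ∫⁻ x, ‖F x‖ₑ ^ 2 ∂μ ≤ ENNReal.ofReal (c ^ 2)) : ‖F‖ ≤ c := by
  rw [← Lp_enorm_sq, ← ofReal_norm, ← ENNReal.ofReal_pow (norm_nonneg _),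
    ENNReal.ofReal_le_ofReal_iff (by positivity)] at h
  exact (sq_le_sq₀ (norm_nonneg _) hc).1 h

lemma Lp_norm_eq_sqrt {X : Type*} [MeasurableSpace X] {μ : Measure X} (F : Lp ℝ 2 μ) :
    ‖F‖ = Real.sqrt (∫ x, (F x) ^ 2 ∂μ) := by
  have h := Lp_enorm_sq F
  rw [shift_lintegral _ _ (Lp.memLp F), ← ofReal_norm, ← ENNReal.ofReal_pow (norm_nonneg _),
    ENNReal.ofReal_eq_ofReal_iff (by positivity) (integral_nonneg fun x => sq_nonneg _)] at h
  rw [← h, Real.sqrt_sq (norm_nonneg _)]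

lemma proj_est {E : Type*} [AddCommGroup E] [MeasurableSpace E] [MeasurableAdd₂ E] [MeasurableNeg E] (μ : Measure E)
    [SFinite μ] [μ.IsAddLeftInvariant] (Q B : Set E) (hQ : MeasurableSet Q) (hQfin : μ Q ≠ ∞)
    (hB : MeasurableSet B) (φ : E → ℝ) (hφ : Measurable φ) (hφ2 : MemLp φ 2 (μ.restrict Q))
    (c : E → Set E) (m : ℝ) (hm : 0 < m)
    (hc : ∀ᵐ x ∂μ.restrict Q, c x ⊆ Q ∧ MeasurableSet (c x) ∧
      μ (c x) = ENNReal.ofReal m⁻¹ ∧ ∀ z ∈ c x, z - x ∈ B)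
    (M : ℝ≥0∞)
    (hM : ∀ h ∈ B, ∫⁻ x in {x | x ∈ Q ∧ x + h ∈ Q}, ‖φ (x + h) - φ x‖ₑ ^ 2 ∂μ ≤ M) :
    ∫⁻ x in Q, ‖φ x - m * ∫ z in c x, φ z ∂μ‖ₑ ^ 2 ∂μ ≤ ENNReal.ofReal m * (μ B * M) := by
  have hmeas : Measurable (fun p : E × E => Q.indicator (fun _ => (1:ℝ≥0∞)) (p.1 + p.2) * ‖φ (p.1 + p.2) - φ p.1‖ₑ ^ 2) := by
    have h1 : Measurable (fun p : E × E => p.1 + p.2) := measurable_add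
    have h2 : Measurable (Q.indicator (fun _ => (1:ℝ≥0∞))) := measurable_const.indicator hQ
    exact (h2.comp h1).mul (((hφ.comp h1).sub (hφ.comp measurable_fst)).enorm.pow_const 2)
  have hpt : ∀ᵐ x ∂μ.restrict Q, ‖φ x - m * ∫ z in c x, φ z ∂μ‖ₑ ^ 2 ≤
      ENNReal.ofReal m * ∫⁻ h in B, Q.indicator (fun _ => (1:ℝ≥0∞)) (x + h) * ‖φ (x + h) - φ x‖ₑ ^ 2 ∂μ := by
    filter_upwards [hc] with x ⟨hcQ, hcm, hcμ, hcB⟩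
    have : IsFiniteMeasure (μ.restrict Q) := ⟨by simpa using hQfin.lt_top⟩
    have : IsFiniteMeasure (μ.restrict (c x)) := ⟨by simp [hcμ]⟩
    have hint : IntegrableOn φ (c x) μ :=
      IntegrableOn.mono_set (hφ2.integrable (by norm_num)) hcQ
    have e1 : φ x - m * ∫ z in c x, φ z ∂μ = m * ∫ z in c x, (φ x - φ z) ∂μ := by
      rw [integral_sub (integrable_const _) hint]
      simp only [MeasureTheory.integral_const, smul_eq_mul, Measure.real, Measure.restrict_apply_univ, hcμ]
      rw [ENNReal.toReal_ofReal (by positivity)]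
      field_simp
    have e2 : ‖∫ z in c x, (φ x - φ z) ∂μ‖ₑ ^ 2 ≤ ENNReal.ofReal m⁻¹ * ∫⁻ z in c x, ‖φ x - φ z‖ₑ ^ 2 ∂μ := by
      refine (pow_le_pow_left' (enorm_integral_le_lintegral_enorm _) 2).trans ?_
      refine (cs_lintegral _ _ (by fun_prop)).trans ?_
      simp [hcμ]
    have e3 : ∫⁻ z in c x, ‖φ x - φ z‖ₑ ^ 2 ∂μ ≤
        ∫⁻ h in B, Q.indicator (fun _ => (1:ℝ≥0∞)) (x + h) * ‖φ (x + h) - φ x‖ₑ ^ 2 ∂μ := by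
      rw [← lintegral_indicator hcm, ← lintegral_indicator hB, ← lintegral_add_left_eq_self _ x]
      refine lintegral_mono fun h => ?_
      by_cases hh : x + h ∈ c x
      · have hb : h ∈ B := by simpa using hcB _ hh
        simp [hh, hb, hcQ hh, enorm_sub_rev]
      · simp [hh]
    rw [e1, enorm_mul, mul_pow]
    calc ‖m‖ₑ ^ 2 * ‖∫ z in c x, (φ x - φ z) ∂μ‖ₑ ^ 2 ≤ 
        ENNReal.ofReal m ^ 2 * (ENNReal.ofReal m⁻¹ * ∫⁻ z in c x, ‖φ x - φ z‖ₑ ^ 2 ∂μ) := by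
          rw [Real.enorm_eq_ofReal hm.le]; gcongr
      _ = ENNReal.ofReal m * ∫⁻ z in c x, ‖φ x - φ z‖ₑ ^ 2 ∂μ := by
          rw [← mul_assoc, sq, mul_assoc (ENNReal.ofReal m), ← ENNReal.ofReal_mul hm.le, mul_inv_cancel₀ hm.ne']
          simp
      _ ≤ _ := by gcongr
  refine (lintegral_mono_ae hpt).trans ?_
  rw [lintegral_const_mul' _ _ (by simp), lintegral_lintegral_swap hmeas.aemeasurable]
  gcongr
  calc _ ≤ ∫⁻ h in B, M ∂μ := by
        refine setLIntegral_mono' hB fun h hh => ?_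
        refine le_trans (le_of_eq ?_) (hM h hh)
        have hS : MeasurableSet {x | x + h ∈ Q} := (measurable_add_const h) hQ
        rw [← lintegral_indicator hQ, ← lintegral_indicator (show MeasurableSet {x | x ∈ Q ∧ x + h ∈ Q} from hQ.inter hS)]
        congr 1; ext x
        by_cases h1 : x ∈ Q <;> by_cases h2 : x + h ∈ Q <;> simp [h1, h2, indicator]
    _ = _ := by simp [mul_comm]

lemma shift_memLp {E : Type*} [AddCommGroup E] [MeasurableSpace E] [MeasurableAdd₂ E] (μ : Measure E)
    [SFinite μ] [μ.IsAddLeftInvariant] (Q : Set E) (hQ : MeasurableSet Q)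
    (φ : E → ℝ) (hφ2 : MemLp φ 2 (μ.restrict Q)) (h : E) :
    MemLp (fun x => φ (x + h) - φ x) 2 (μ.restrict {x | x ∈ Q ∧ x + h ∈ Q}) := by
  have h1 : MemLp φ 2 (μ.restrict {x | x ∈ Q ∧ x + h ∈ Q}) :=
    hφ2.mono_measure (Measure.restrict_mono (fun x hx => hx.1) le_rfl)
  have mp := (measurePreserving_add_right μ h).restrict_preimage hQ
  have h2 : MemLp (fun x => φ (x + h)) 2 (μ.restrict {x | x ∈ Q ∧ x + h ∈ Q}) :=
    (hφ2.comp_measurePreserving mp).mono_measure (Measure.restrict_mono (fun x hx => hx.2) le_rfl)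
  exact h2.sub h1


lemma gronwall_int (φ : ℝ → ℝ) (T a L : ℝ) (hL : 0 ≤ L) (hφ : ContinuousOn φ (Icc 0 T))
    (h : ∀ t ∈ Icc (0:ℝ) T, φ t ≤ a + L * ∫ s in (0:ℝ)..t, φ s) :
    ∀ t ∈ Icc (0:ℝ) T, φ t ≤ a * Real.exp (L * t) := by
  intro t ht
  have hT : (0:ℝ) ≤ T := ht.1.trans ht.2
  set ψ : ℝ → ℝ := IccExtend hT (fun x : Icc (0:ℝ) T => φ x) with hψ
  have hψc : Continuous ψ := (continuousOn_iff_continuous_domRestrict.1 hφ).Icc_extend'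
  have heq : ∀ s ∈ Icc (0:ℝ) T, ψ s = φ s := fun s hs => IccExtend_of_mem hT _ hs
  set P : ℝ → ℝ := fun t => ∫ s in (0:ℝ)..t, ψ s with hP
  have hPd : ∀ t, HasDerivAt P (ψ t) t := fun t =>
    intervalIntegral.integral_hasDerivAt_right (hψc.intervalIntegrable _ _)
      (hψc.stronglyMeasurableAtFilter _ _) hψc.continuousAt
  have hPe : ∀ t ∈ Icc (0:ℝ) T, ∫ s in (0:ℝ)..t, φ s = P t := by
    intro t ht
    refine intervalIntegral.integral_congr fun s hs => ?_
    rw [uIcc_of_le ht.1] at hs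
    exact (heq s ⟨hs.1, hs.2.trans ht.2⟩).symm
  set G : ℝ → ℝ := fun t => (a + L * P t) * Real.exp (-(L * t)) with hG
  have hGd : ∀ t, HasDerivAt G (L * ψ t * Real.exp (-(L * t)) +
      (a + L * P t) * (Real.exp (-(L * t)) * -(L * 1))) t := fun t =>
    (((hPd t).const_mul L).const_add a).mul (((hasDerivAt_id t).const_mul L).neg.exp)
  have hanti : AntitoneOn G (Icc 0 T) := by
    refine antitoneOn_of_deriv_nonpos (convex_Icc _ _) (fun t _ => (hGd t).continuousAt.continuousWithinAt)
      (fun t _ => (hGd t).differentiableAt.differentiableWithinAt) fun t ht => ?_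
    rw [interior_Icc] at ht
    have ht' := Ioo_subset_Icc_self ht
    rw [(hGd t).deriv]
    have h1 := h t ht'
    rw [hPe t ht', ← heq t ht'] at h1
    have h2 := mul_nonneg (mul_nonneg hL (Real.exp_pos (-(L * t))).le) (sub_nonneg.2 h1)
    linarith
  have h0 := hanti (left_mem_Icc.2 hT) ht ht.1
  have h1 := h t ht
  rw [hPe t ht] at h1
  simp only [hG, hP, intervalIntegral.integral_same, mul_zero, neg_zero, Real.exp_zero, add_zero, mul_one] at h0
  refine h1.trans ?_
  rw [Real.exp_neg, ← div_eq_mul_inv, div_le_iff₀ (Real.exp_pos _)] at h0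
  exact h0

lemma cs_real {X : Type*} [MeasurableSpace X] (μ : Measure X) [IsProbabilityMeasure μ]
    (a b : X → ℝ) (ha : MemLp a 2 μ) (hb : MemLp b 2 μ) :
    ∫ x, |a x| * |b x| ∂μ ≤ Real.sqrt (∫ x, a x ^ 2 ∂μ) * Real.sqrt (∫ x, b x ^ 2 ∂μ) := by
  have h := integral_mul_norm_le_Lp_mul_Lq (μ := μ) (f := a) (g := b) Real.HolderConjugate.two_two
    (by simpa using ha) (by simpa using hb)
  simpa [Real.sqrt_eq_rpow] using h

section nonlocal
variable {X : Type*} [MeasurableSpace X] {μ : Measure X} [IsProbabilityMeasure μ]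

lemma nonlocal_integrable (k : X → X → ℝ) (hk : Measurable (Function.uncurry k))
    (S : ℝ → ℝ → ℝ) (A : ℝ) (hS : Continuous (Function.uncurry S)) (hA : ∀ a b, |S a b| ≤ A)
    (v : Lp ℝ 2 μ) (x : X) (hx : Integrable (fun y => k x y ^ 2) μ) (a : ℝ) :
    Integrable (fun y => k x y * S a (v y)) μ := by
  have hm : Measurable (k x) := hk.comp measurable_prodMk_left
  have h2 : MemLp (k x) 2 μ := (memLp_two_iff_integrable_sq hm.aestronglyMeasurable).2 hx
  have hSm : AEStronglyMeasurable (fun y => S a (v y)) μ :=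
    (show Continuous fun b => S a b from hS.comp (by fun_prop : Continuous fun b : ℝ => (a, b))).comp_aestronglyMeasurable
      (Lp.aestronglyMeasurable v)
  exact (h2.integrable (by norm_num)).mul_bdd (c := A) hSm (ae_of_all _ fun y => by simpa using hA _ _)

lemma nonlocal_lip (k : X → X → ℝ) (hk : Measurable (Function.uncurry k)) (κ : ℝ)
    (hκ : ∀ᵐ x ∂μ, Integrable (fun y => k x y ^ 2) μ ∧ ∫ y, k x y ^ 2 ∂μ ≤ κ)
    (S : ℝ → ℝ → ℝ) (A L : ℝ) (hL : 0 ≤ L) (hS : Continuous (Function.uncurry S)) (hA : ∀ a b, |S a b| ≤ A)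
    (hSlip : ∀ a b a' b' : ℝ, |S a b - S a' b'| ≤ L * (|a - a'| + |b - b'|))
    (v v' : Lp ℝ 2 μ) :
    ∀ᵐ x ∂μ, |(∫ y, k x y * S (v x) (v y) ∂μ) - ∫ y, k x y * S (v' x) (v' y) ∂μ| ≤
      L * Real.sqrt κ * (|v x - v' x| + ‖v - v'‖) := by
  filter_upwards [hκ] with x ⟨hx, hxκ⟩
  have hm : Measurable (k x) := hk.comp measurable_prodMk_left
  have h2 : MemLp (k x) 2 μ := (memLp_two_iff_integrable_sq hm.aestronglyMeasurable).2 hx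
  have hδ : MemLp (fun y => (v - v' : Lp ℝ 2 μ) y) 2 μ := Lp.memLp _
  rw [← integral_sub (nonlocal_integrable k hk S A hS hA v x hx _) (nonlocal_integrable k hk S A hS hA v' x hx _)]
  have hi1 : Integrable (fun y => |k x y| * |v x - v' x|) μ :=
    (h2.integrable (by norm_num)).abs.mul_const _
  have hi2 : Integrable (fun y => |k x y| * |(v - v' : Lp ℝ 2 μ) y|) μ := by
    exact h2.abs.integrable_mul hδ.abs
  have c1 := cs_real μ (k x) (fun _ => 1) h2 (memLp_const _)
  have c2 := cs_real μ (k x) _ h2 hδ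
  rw [← Lp_norm_eq_sqrt] at c2
  simp at c1
  have hsq := Real.sqrt_le_sqrt hxκ
  calc |∫ y, (k x y * S (v x) (v y) - k x y * S (v' x) (v' y)) ∂μ|
      ≤ ∫ y, L * (|k x y| * |v x - v' x| + |k x y| * |(v - v' : Lp ℝ 2 μ) y|) ∂μ := by
        rw [← Real.norm_eq_abs]
        refine (MeasureTheory.norm_integral_le_integral_norm _).trans ?_
        refine integral_mono_of_nonneg (ae_of_all _ fun y => norm_nonneg _) ((hi1.add hi2).const_mul L) ?_
        filter_upwards [Lp.coeFn_sub v v'] with y hy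
        rw [hy, ← mul_sub, norm_mul, Real.norm_eq_abs, Real.norm_eq_abs, Pi.sub_apply]
        have := mul_le_mul_of_nonneg_left (hSlip (v x) (v y) (v' x) (v' y)) (abs_nonneg (k x y))
        linarith
    _ = L * ((∫ y, |k x y| ∂μ) * |v x - v' x| + ∫ y, |k x y| * |(v - v' : Lp ℝ 2 μ) y| ∂μ) := by
        rw [MeasureTheory.integral_const_mul, integral_add hi1 hi2, MeasureTheory.integral_mul_const]
    _ ≤ L * (Real.sqrt κ * |v x - v' x| + Real.sqrt κ * ‖v - v'‖) := by
        gcongr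
        · exact c1.trans hsq
        · exact c2.trans (by gcongr)
    _ = _ := by ring

lemma N_lip (k : X → X → ℝ) (hk : Measurable (Function.uncurry k)) (κ : ℝ)
    (hκ : ∀ᵐ x ∂μ, Integrable (fun y => k x y ^ 2) μ ∧ ∫ y, k x y ^ 2 ∂μ ≤ κ)
    (S : ℝ → ℝ → ℝ) (A L : ℝ) (hL : 0 ≤ L) (hS : Continuous (Function.uncurry S)) (hA : ∀ a b, |S a b| ≤ A)
    (hSlip : ∀ a b a' b' : ℝ, |S a b - S a' b'| ≤ L * (|a - a'| + |b - b'|))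
    (f : ℝ → ℝ) (Lf : ℝ) (hLf : 0 ≤ Lf) (hf : ∀ a b, |f a - f b| ≤ Lf * |a - b|)
    (N : Lp ℝ 2 μ → Lp ℝ 2 μ)
    (hN : ∀ v : Lp ℝ 2 μ, N v =ᵐ[μ] fun x => f (v x) + ∫ y, k x y * S (v x) (v y) ∂μ)
    (v v' : Lp ℝ 2 μ) : ‖N v - N v'‖ ≤ (Lf + 2 * (L * Real.sqrt κ)) * ‖v - v'‖ := by
  set c := L * Real.sqrt κ with hc
  have hc0 : 0 ≤ c := by positivity
  set G : Lp ℝ 2 μ := (Lf + c) • |v - v'| + Lp.const 2 μ (c * ‖v - v'‖) with hG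
  have hle : ‖N v - N v'‖ ≤ ‖G‖ := by
    refine Lp.norm_le_norm_of_ae_le ?_
    filter_upwards [nonlocal_lip k hk κ hκ S A L hL hS hA hSlip v v', hN v, hN v', Lp.coeFn_sub v v',
      Lp.coeFn_sub (N v) (N v'), Lp.coeFn_add ((Lf + c) • |v - v'|) (Lp.const 2 μ (c * ‖v - v'‖)),
      Lp.coeFn_smul (Lf + c) |v - v'|, Lp.coeFn_abs (v - v'), Lp.coeFn_const (p := 2) (μ := μ) (c * ‖v - v'‖)]
      with x h1 h2 h3 h4 h5 h6 h7 h8 h9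
    rw [h5, hG, h6, Pi.sub_apply, h2, h3, Pi.add_apply, h7, h9, Pi.smul_apply, h8, h4]
    simp only [Pi.sub_apply, smul_eq_mul, Function.const_apply, Real.norm_eq_abs]
    rw [abs_of_nonneg (a := (Lf + c) * _ + _) (by positivity)]
    have := hf (v x) (v' x)
    rw [add_sub_add_comm]
    refine (abs_add_le _ _).trans ?_
    linarith
  refine hle.trans ((norm_add_le _ _).trans ?_)
  have h1 := Lp.norm_const_le (p := 2) (μ := μ) (c := c * ‖v - v'‖)
  rw [norm_smul, norm_abs_eq_norm, Real.norm_of_nonneg (by positivity)]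
  simp only [probReal_univ, Real.one_rpow, mul_one] at h1
  rw [Real.norm_of_nonneg (by positivity)] at h1
  linarith

lemma N_cont (k : X → X → ℝ) (hk : Measurable (Function.uncurry k)) (κ : ℝ)
    (hκ : ∀ᵐ x ∂μ, Integrable (fun y => k x y ^ 2) μ ∧ ∫ y, k x y ^ 2 ∂μ ≤ κ)
    (S : ℝ → ℝ → ℝ) (A L : ℝ) (hL : 0 ≤ L) (hS : Continuous (Function.uncurry S)) (hA : ∀ a b, |S a b| ≤ A)
    (hSlip : ∀ a b a' b' : ℝ, |S a b - S a' b'| ≤ L * (|a - a'| + |b - b'|))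
    (T : ℝ) (f : ℝ → ℝ → ℝ) (hfc : Continuous (Function.uncurry f))
    (Af Bf Lf : ℝ) (hLf : 0 ≤ Lf)
    (hfb : ∀ t ∈ Icc (0:ℝ) T, ∀ a, |f t a| ≤ Af + Bf * |a|)
    (hf : ∀ t ∈ Icc (0:ℝ) T, ∀ a b, |f t a - f t b| ≤ Lf * |a - b|)
    (N : ℝ → Lp ℝ 2 μ → Lp ℝ 2 μ)
    (hN : ∀ s ∈ Icc (0:ℝ) T, ∀ v : Lp ℝ 2 μ, N s v =ᵐ[μ] fun x => f s (v x) + ∫ y, k x y * S (v x) (v y) ∂μ)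
    (u : ℝ → Lp ℝ 2 μ) (hu : ContinuousOn u (Icc 0 T)) :
    ContinuousOn (fun s => N s (u s)) (Icc 0 T) := by
  intro s₀ hs₀
  set v := u s₀ with hv
  have hDCT : Filter.Tendsto (fun s => ∫ x, (f s (v x) - f s₀ (v x)) ^ 2 ∂μ) (nhdsWithin s₀ (Icc 0 T)) (nhds 0) := by
    have h0 : ∫ x, (f s₀ (v x) - f s₀ (v x)) ^ 2 ∂μ = 0 := by simp
    have hvm := Lp.memLp v
    refine Eq.subst (motive := fun r => Filter.Tendsto _ _ (nhds r)) h0 ?_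
    refine tendsto_integral_filter_of_dominated_convergence (fun x => (2 * (Af + Bf * |v x|)) ^ 2) ?_ ?_ ?_ ?_
    · refine Filter.Eventually.of_forall fun s => ?_
      have : Continuous fun a => (f s a - f s₀ a) ^ 2 := by
        have h1 : Continuous fun a => f s a := hfc.comp (by fun_prop : Continuous fun a : ℝ => (s, a))
        have h2 : Continuous fun a => f s₀ a := hfc.comp (by fun_prop : Continuous fun a : ℝ => (s₀, a))
        fun_prop
      exact this.comp_aestronglyMeasurable hvm.aestronglyMeasurable
    · filter_upwards [self_mem_nhdsWithin] with s hs
      refine ae_of_all _ fun x => ?_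
      rw [Real.norm_of_nonneg (sq_nonneg _), ← sq_abs]
      have := hfb s hs (v x)
      have := hfb s₀ hs₀ (v x)
      have := abs_sub (f s (v x)) (f s₀ (v x))
      gcongr
      linarith
    · have : MemLp (fun x => 2 * (Af + Bf * |v x|)) 2 μ :=
        ((memLp_const Af).add (hvm.abs.const_mul Bf)).const_mul 2
      exact this.integrable_sq
    · refine ae_of_all _ fun x => ?_
      have h1 : Continuous fun s => (f s (v x) - f s₀ (v x)) ^ 2 := by
        have : Continuous fun s => f s (v x) := hfc.comp (by fun_prop : Continuous fun s : ℝ => (s, v x))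
        fun_prop
      exact h1.continuousAt.tendsto.mono_left nhdsWithin_le_nhds
  have hfix : Filter.Tendsto (fun s => ‖N s v - N s₀ v‖) (nhdsWithin s₀ (Icc 0 T)) (nhds 0) := by
    have h := hDCT.sqrt
    rw [Real.sqrt_zero] at h
    refine h.congr' ?_
    filter_upwards [self_mem_nhdsWithin] with s hs
    rw [Lp_norm_eq_sqrt]
    congr 1
    refine integral_congr_ae ?_
    filter_upwards [hN s hs v, hN s₀ hs₀ v, Lp.coeFn_sub (N s v) (N s₀ v)] with x h1 h2 h3
    rw [h3, Pi.sub_apply, h1, h2]; ring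
  have hu' : Filter.Tendsto (fun s => ‖u s - v‖) (nhdsWithin s₀ (Icc 0 T)) (nhds 0) :=
    tendsto_iff_norm_sub_tendsto_zero.1 (hu s₀ hs₀)
  refine tendsto_iff_norm_sub_tendsto_zero.2 ?_
  have hsum := (hu'.const_mul (Lf + 2 * (L * Real.sqrt κ))).add hfix
  rw [mul_zero, add_zero] at hsum
  refine squeeze_zero' (Filter.Eventually.of_forall fun s => norm_nonneg _) ?_ hsum
  filter_upwards [self_mem_nhdsWithin] with s hs
  have h1 := N_lip k hk κ hκ S A L hL hS hA hSlip (f s) Lf hLf (hf s hs) (N s) (hN s hs) (u s) v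
  have h2 := norm_sub_le_norm_sub_add_norm_sub (N s (u s)) (N s v) (N s₀ v)
  exact h2.trans (by gcongr)

lemma N_diff (k k' : X → X → ℝ) (hk : Measurable (Function.uncurry k)) (hk' : Measurable (Function.uncurry k'))
    (hκ : ∀ᵐ x ∂μ, Integrable (fun y => k x y ^ 2) μ)
    (hκ' : ∀ᵐ x ∂μ, Integrable (fun y => k' x y ^ 2) μ)
    (S : ℝ → ℝ → ℝ) (A : ℝ) (hA0 : 0 ≤ A) (hS : Continuous (Function.uncurry S)) (hA : ∀ a b, |S a b| ≤ A)
    (f : ℝ → ℝ) (N N' : Lp ℝ 2 μ → Lp ℝ 2 μ)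
    (hN : ∀ v : Lp ℝ 2 μ, N v =ᵐ[μ] fun x => f (v x) + ∫ y, k x y * S (v x) (v y) ∂μ)
    (hN' : ∀ v : Lp ℝ 2 μ, N' v =ᵐ[μ] fun x => f (v x) + ∫ y, k' x y * S (v x) (v y) ∂μ)
    (e : ℝ) (he : 0 ≤ e)
    (hkk : ∫⁻ z, ‖k z.1 z.2 - k' z.1 z.2‖ₑ ^ 2 ∂(μ.prod μ) ≤ ENNReal.ofReal (e ^ 2))
    (v : Lp ℝ 2 μ) : ‖N v - N' v‖ ≤ A * e := by
  refine Lp_norm_le _ _ (by positivity) ?_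
  have hmz : Measurable (fun z : X × X => ‖k z.1 z.2 - k' z.1 z.2‖ₑ ^ 2) :=
    (hk.sub hk').enorm.pow_const 2
  rw [lintegral_prod _ hmz.aemeasurable] at hkk
  calc ∫⁻ x, ‖(N v - N' v : Lp ℝ 2 μ) x‖ₑ ^ 2 ∂μ
      ≤ ∫⁻ x, ENNReal.ofReal A ^ 2 * ∫⁻ y, ‖k x y - k' x y‖ₑ ^ 2 ∂μ ∂μ := by
        refine lintegral_mono_ae ?_
        filter_upwards [hκ, hκ', hN v, hN' v, Lp.coeFn_sub (N v) (N' v)] with x h1 h2 h3 h4 h5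
        rw [h5, Pi.sub_apply, h3, h4, add_sub_add_left_eq_sub,
          ← integral_sub (nonlocal_integrable k hk S A hS hA v x h1 _) (nonlocal_integrable k' hk' S A hS hA v x h2 _)]
        have hb : ‖∫ y, (k x y * S (v x) (v y) - k' x y * S (v x) (v y)) ∂μ‖ₑ ≤
            ENNReal.ofReal A * ∫⁻ y, ‖k x y - k' x y‖ₑ ∂μ := by
          refine (enorm_integral_le_lintegral_enorm _).trans ?_
          rw [← lintegral_const_mul' _ _ (by simp)]
          refine lintegral_mono fun y => ?_
          rw [← sub_mul, enorm_mul, mul_comm]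
          gcongr
          rw [← ofReal_norm]
          exact ENNReal.ofReal_le_ofReal (hA _ _)
        refine (pow_le_pow_left' hb 2).trans ?_
        rw [mul_pow]
        gcongr
        have hm : Measurable (fun y => k x y - k' x y) :=
          (hk.comp measurable_prodMk_left).sub (hk'.comp measurable_prodMk_left)
        refine (cs_lintegral μ _ hm.enorm.aemeasurable).trans ?_
        simp
    _ = ENNReal.ofReal A ^ 2 * ∫⁻ x, ∫⁻ y, ‖k x y - k' x y‖ₑ ^ 2 ∂μ ∂μ := by
        rw [lintegral_const_mul' _ _ (by simp)]
    _ ≤ ENNReal.ofReal A ^ 2 * ENNReal.ofReal (e ^ 2) := by gcongr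
    _ = _ := by rw [← ENNReal.ofReal_pow hA0, ← ENNReal.ofReal_mul (by positivity), mul_pow]

end nonlocal

section geometry

lemma unitCube_meas (d : ℕ) : MeasurableSet (unitCube d) := measurableSet_Icc

lemma volume_unitCube (d : ℕ) : volume (unitCube d) = 1 := by
  rw [unitCube, Real.volume_Icc_pi]; simp

instance (d : ℕ) : IsProbabilityMeasure (cubeMeasure d) :=
  ⟨by rw [cubeMeasure, Measure.restrict_apply_univ, volume_unitCube]⟩

lemma cube_ae_pos (d : ℕ) : ∀ᵐ x ∂cubeMeasure d, ∀ l, 0 < x l ∧ x l ≤ 1 := by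
  have h : (volume : Measure (Fin d → ℝ)).restrict (unitCube d) =
      volume.restrict (univ.pi fun _ => Ioc (0:ℝ) 1) := by
    refine Measure.restrict_congr_set ?_
    exact (Measure.univ_pi_Ioc_ae_eq_Icc (μ := fun _ : Fin d => (volume : Measure ℝ))
      (f := 0) (g := 1)).symm
  rw [cubeMeasure, h]
  filter_upwards [ae_restrict_mem (MeasurableSet.univ_pi fun _ => measurableSet_Ioc)] with x hx l
  exact hx l (mem_univ l)

def hBox (d n : ℕ) : Set (Fin d → ℝ) := Icc (fun _ => -(1 / (n:ℝ))) (fun _ => 1 / (n:ℝ))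

lemma hBox_meas (d n : ℕ) : MeasurableSet (hBox d n) := measurableSet_Icc

lemma hBox_vol (d n : ℕ) : volume (hBox d n) = ENNReal.ofReal ((2 / (n:ℝ)) ^ d) := by
  rw [hBox, Real.volume_Icc_pi, ENNReal.ofReal_pow (by positivity)]
  simp only [Finset.prod_const, Finset.card_univ, Fintype.card_fin]
  congr 2; ring

lemma hBox_sum (d n : ℕ) (h : Fin d → ℝ) (hh : h ∈ hBox d n) :
    ∑ i, h i ^ 2 ≤ d * (1 / (n:ℝ)) ^ 2 := by
  calc ∑ i, h i ^ 2 ≤ ∑ _i : Fin d, (1 / (n:ℝ)) ^ 2 :=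
        Finset.sum_le_sum fun i _ => sq_le_sq' (hh.1 i) (hh.2 i)
    _ = _ := by simp

lemma cell_props (d n : ℕ) (hn : 1 ≤ n) (x : Fin d → ℝ) (hx : ∀ l, 0 < x l ∧ x l ≤ 1) :
    cellOf d n x ⊆ unitCube d ∧ MeasurableSet (cellOf d n x) ∧
      volume (cellOf d n x) = ENNReal.ofReal (((n:ℝ) ^ d)⁻¹) ∧
      ∀ z ∈ cellOf d n x, z - x ∈ hBox d n := by
  have hn0 : (0:ℝ) < n := by exact_mod_cast hn
  refine ⟨?_, MeasurableSet.univ_pi fun _ => measurableSet_Ioc, ?_, ?_⟩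
  · intro z hz
    refine ⟨fun l => ?_, fun l => ?_⟩
    · have h1 := (hz l (mem_univ l)).1
      have h2 : (1:ℤ) ≤ ⌈(n:ℝ) * x l⌉ := by
        have := Int.ceil_pos.2 (mul_pos hn0 (hx l).1); omega
      have h3 : (1:ℝ) ≤ (⌈(n:ℝ) * x l⌉ : ℝ) := by exact_mod_cast h2
      exact (div_nonneg (by linarith) hn0.le).trans h1.le
    · have h1 := (hz l (mem_univ l)).2
      have h2 : ⌈(n:ℝ) * x l⌉ ≤ (n:ℤ) := Int.ceil_le.2 (by
        have := mul_le_mul_of_nonneg_left (hx l).2 hn0.le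
        push_cast; linarith)
      have h3 : (⌈(n:ℝ) * x l⌉ : ℝ) ≤ n := by exact_mod_cast h2
      exact h1.trans ((div_le_one hn0).2 h3)
  · rw [cellOf, Real.volume_pi_Ioc]
    have : ∀ l : Fin d, (⌈(n:ℝ) * x l⌉ : ℝ) / n - ((⌈(n:ℝ) * x l⌉ : ℝ) - 1) / n = (n:ℝ)⁻¹ := by
      intro l; field_simp; ring
    simp only [this, Finset.prod_const, Finset.card_univ, Fintype.card_fin]
    rw [← ENNReal.ofReal_pow (by positivity), inv_pow]
  · intro z hz
    have key : ∀ l, |z l - x l| ≤ 1 / n := by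
      intro l
      have h1 := hz l (mem_univ l)
      have h2 := Int.ceil_lt_add_one ((n:ℝ) * x l)
      have h3 := Int.le_ceil ((n:ℝ) * x l)
      have h4 := (div_lt_iff₀ hn0).1 h1.1
      have h5 := (le_div_iff₀ hn0).1 h1.2
      rw [le_div_iff₀ hn0, ← abs_of_pos hn0, ← abs_mul, abs_le]
      constructor <;> linarith
    exact ⟨fun l => (abs_le.1 (key l)).1, fun l => (abs_le.1 (key l)).2⟩

lemma memLp_g (d : ℕ) (g : Lp ℝ 2 (cubeMeasure d)) : MemLp g 2 (volume.restrict (unitCube d)) :=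
  Lp.memLp g

lemma proj_g (d n : ℕ) (hn : 1 ≤ n) (g : Lp ℝ 2 (cubeMeasure d)) (α : ℝ) (hα : 0 < α) (Λg : ℝ) (hΛ : 0 ≤ Λg)
    (hgLip : ∀ h : Fin d → ℝ, 0 < euclNorm d h → euclNorm d h ≤ Real.sqrt d →
      (∫ x in {x | x ∈ unitCube d ∧ x + h ∈ unitCube d},
        ((g : (Fin d → ℝ) → ℝ) (x + h) - (g : (Fin d → ℝ) → ℝ) x) ^ 2) ≤
          (Λg * euclNorm d h ^ α) ^ 2) :
    ∫⁻ x, ‖g x - cellAvg d n g x‖ₑ ^ 2 ∂cubeMeasure d ≤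
      ENNReal.ofReal ((Real.sqrt (2 ^ d) * Λg * Real.sqrt d ^ α * (n:ℝ) ^ (-α)) ^ 2) := by
  have hn0 : (0:ℝ) < n := by exact_mod_cast hn
  have hn1 : (1:ℝ) ≤ n := by exact_mod_cast hn
  have h := proj_est volume (unitCube d) (hBox d n) (unitCube_meas d) (by simp [volume_unitCube])
    (hBox_meas d n) g (Lp.stronglyMeasurable g).measurable (memLp_g d g)
    (cellOf d n) ((n:ℝ) ^ d) (by positivity)
    (by filter_upwards [cube_ae_pos d] with x hx using cell_props d n hn x hx)
    (ENNReal.ofReal ((Λg * (Real.sqrt d / n) ^ α) ^ 2)) (by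
      intro h hh
      rw [shift_lintegral _ _ (shift_memLp volume (unitCube d) (unitCube_meas d) g (memLp_g d g) h)]
      refine ENNReal.ofReal_le_ofReal ?_
      have hle : euclNorm d h ≤ Real.sqrt d / n := by
        have := Real.sqrt_le_sqrt (hBox_sum d n h hh)
        rw [Real.sqrt_mul (by positivity), Real.sqrt_sq (by positivity)] at this
        simpa [euclNorm, div_eq_mul_inv] using this
      have h0 : 0 ≤ euclNorm d h := Real.sqrt_nonneg _
      rcases h0.eq_or_lt with h0 | h0
      · have : h = 0 := by
          rw [euclNorm, eq_comm, Real.sqrt_eq_zero (Finset.sum_nonneg fun _ _ => sq_nonneg _),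
            Finset.sum_eq_zero_iff_of_nonneg fun _ _ => sq_nonneg _] at h0
          ext i; simpa using h0 i (Finset.mem_univ i)
        subst this
        simp; positivity
      · refine (hgLip h h0 (hle.trans (div_le_self (Real.sqrt_nonneg _) hn1))).trans ?_
        gcongr)
  refine h.trans (le_of_eq ?_)
  rw [hBox_vol, ← ENNReal.ofReal_mul (by positivity), ← ENNReal.ofReal_mul (by positivity)]
  congr 1
  rw [Real.div_rpow (by positivity) hn0.le, Real.rpow_neg hn0.le]
  simp only [mul_pow, div_pow]
  rw [Real.sq_sqrt (by positivity)]
  field_simp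

lemma cubeMeasure_prod (d : ℕ) : (cubeMeasure d).prod (cubeMeasure d) =
    (volume : Measure ((Fin d → ℝ) × (Fin d → ℝ))).restrict (unitCube d ×ˢ unitCube d) := by
  rw [cubeMeasure, Measure.prod_restrict]; rfl

lemma memLp_K (d : ℕ) (K : (Fin d → ℝ) → (Fin d → ℝ) → ℝ) (hKmeas : Measurable (Function.uncurry K))
    (K₁ : ℝ)
    (hK1 : ∀ᵐ x ∂cubeMeasure d,
      Integrable (fun y => (K x y) ^ 2) (cubeMeasure d) ∧
        (∫ y, (K x y) ^ 2 ∂cubeMeasure d) ≤ K₁) :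
    MemLp (Function.uncurry K) 2 ((cubeMeasure d).prod (cubeMeasure d)) := by
  rw [memLp_two_iff_integrable_sq hKmeas.aestronglyMeasurable]
  have hm : Measurable fun z => Function.uncurry K z ^ 2 := hKmeas.pow_const 2
  rw [integrable_prod_iff hm.aestronglyMeasurable]
  refine ⟨hK1.mono fun x hx => hx.1, ?_⟩
  refine Integrable.mono' (integrable_const K₁) ?_ ?_
  · exact hm.norm.stronglyMeasurable.integral_prod_right'.aestronglyMeasurable
  · filter_upwards [hK1] with x hx
    rw [Real.norm_of_nonneg (integral_nonneg fun _ => norm_nonneg _)]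
    simpa using hx.2

lemma proj_K (d n : ℕ) (hn : 1 ≤ n) (K : (Fin d → ℝ) → (Fin d → ℝ) → ℝ)
    (hKmeas : Measurable (Function.uncurry K))
    (hKL : MemLp (Function.uncurry K) 2 ((cubeMeasure d).prod (cubeMeasure d)))
    (β : ℝ) (hβ : 0 < β) (ΛK : ℝ) (hΛ : 0 ≤ ΛK)
    (hKLip : ∀ h₁ h₂ : Fin d → ℝ,
      0 < Real.sqrt (∑ i, (h₁ i) ^ 2 + ∑ i, (h₂ i) ^ 2) →
      Real.sqrt (∑ i, (h₁ i) ^ 2 + ∑ i, (h₂ i) ^ 2) ≤ Real.sqrt (2 * d) →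
      (∫ x in {x | x ∈ unitCube d ∧ x + h₁ ∈ unitCube d},
        ∫ y in {y | y ∈ unitCube d ∧ y + h₂ ∈ unitCube d},
          (K (x + h₁) (y + h₂) - K x y) ^ 2) ≤
        (ΛK * Real.sqrt (∑ i, (h₁ i) ^ 2 + ∑ i, (h₂ i) ^ 2) ^ β) ^ 2) :
    ∫⁻ z, ‖K z.1 z.2 - cellAvgKer d n K z.1 z.2‖ₑ ^ 2 ∂((cubeMeasure d).prod (cubeMeasure d)) ≤
      ENNReal.ofReal ((2 ^ d * ΛK * Real.sqrt (2 * d) ^ β * (n:ℝ) ^ (-β)) ^ 2) := by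
  have hn0 : (0:ℝ) < n := by exact_mod_cast hn
  have hn1 : (1:ℝ) ≤ n := by exact_mod_cast hn
  have hQm := (unitCube_meas d).prod (unitCube_meas d)
  have hvQ : volume (unitCube d ×ˢ unitCube d) = 1 := by
    rw [Measure.volume_eq_prod, Measure.prod_prod, volume_unitCube, one_mul]
  have hae : ∀ᵐ z ∂((cubeMeasure d).prod (cubeMeasure d)),
      (∀ l, 0 < z.1 l ∧ z.1 l ≤ 1) ∧ (∀ l, 0 < z.2 l ∧ z.2 l ≤ 1) :=
    (Measure.quasiMeasurePreserving_fst.ae (cube_ae_pos d)).and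
      (Measure.quasiMeasurePreserving_snd.ae (cube_ae_pos d))
  have hinv : (volume : Measure ((Fin d → ℝ) × (Fin d → ℝ))).IsAddLeftInvariant := by
    rw [Measure.volume_eq_prod]; infer_instance
  have hKL' := hKL
  rw [cubeMeasure_prod] at hKL'
  have hKi : IntegrableOn (Function.uncurry K) (unitCube d ×ˢ unitCube d) := by
    have := hKL.integrable (by norm_num)
    rwa [cubeMeasure_prod] at this
  have h := proj_est (volume : Measure ((Fin d → ℝ) × (Fin d → ℝ))) (unitCube d ×ˢ unitCube d)
    (hBox d n ×ˢ hBox d n) hQm (by simp [hvQ])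
    ((hBox_meas d n).prod (hBox_meas d n)) (Function.uncurry K) hKmeas hKL'
    (fun z => cellOf d n z.1 ×ˢ cellOf d n z.2) ((n:ℝ) ^ d * (n:ℝ) ^ d) (by positivity)
    (by
      rw [← cubeMeasure_prod]
      filter_upwards [hae] with z ⟨hz1, hz2⟩
      obtain ⟨a1, a2, a3, a4⟩ := cell_props d n hn z.1 hz1
      obtain ⟨b1, b2, b3, b4⟩ := cell_props d n hn z.2 hz2
      refine ⟨prod_mono a1 b1, a2.prod b2, ?_, fun w hw => ⟨a4 _ hw.1, b4 _ hw.2⟩⟩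
      rw [Measure.volume_eq_prod, Measure.prod_prod, a3, b3, ← ENNReal.ofReal_mul (by positivity), mul_inv])
    (ENNReal.ofReal ((ΛK * (Real.sqrt (2 * d) / n) ^ β) ^ 2)) (by
      rintro ⟨h1, h2⟩ ⟨hh1, hh2⟩
      have hsh := shift_memLp volume _ hQm _ hKL' (h1, h2)
      rw [shift_lintegral _ _ hsh]
      have hset : {z : (Fin d → ℝ) × (Fin d → ℝ) | z ∈ unitCube d ×ˢ unitCube d ∧ z + (h1, h2) ∈ unitCube d ×ˢ unitCube d}
        = {x | x ∈ unitCube d ∧ x + h1 ∈ unitCube d} ×ˢ {y | y ∈ unitCube d ∧ y + h2 ∈ unitCube d} := by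
        ext z; simp only [mem_prod, mem_ofPred_eq, Prod.fst_add, Prod.snd_add]; tauto
      have hint := hsh.integrable_sq
      rw [hset] at hint ⊢
      rw [Measure.volume_eq_prod, setIntegral_prod _ hint]
      refine ENNReal.ofReal_le_ofReal ?_
      have hle : Real.sqrt (∑ i, (h1 i) ^ 2 + ∑ i, (h2 i) ^ 2) ≤ Real.sqrt (2 * d) / n := by
        have := Real.sqrt_le_sqrt (add_le_add (hBox_sum d n h1 hh1) (hBox_sum d n h2 hh2))
        rw [← two_mul, ← mul_assoc, Real.sqrt_mul (by positivity), Real.sqrt_sq (by positivity)] at this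
        simpa [div_eq_mul_inv] using this
      have e1 : 0 ≤ ∑ i, (h1 i) ^ 2 := Finset.sum_nonneg fun _ _ => sq_nonneg _
      have e2 : 0 ≤ ∑ i, (h2 i) ^ 2 := Finset.sum_nonneg fun _ _ => sq_nonneg _
      have h0 : 0 ≤ Real.sqrt (∑ i, (h1 i) ^ 2 + ∑ i, (h2 i) ^ 2) := Real.sqrt_nonneg _
      rcases h0.eq_or_lt with h0 | h0
      · rw [eq_comm, Real.sqrt_eq_zero (by positivity)] at h0
        have z1 : h1 = 0 := by
          have : ∑ i, (h1 i) ^ 2 = 0 := by linarith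
          rw [Finset.sum_eq_zero_iff_of_nonneg fun _ _ => sq_nonneg _] at this
          ext i; simpa using this i (Finset.mem_univ i)
        have z2 : h2 = 0 := by
          have : ∑ i, (h2 i) ^ 2 = 0 := by linarith
          rw [Finset.sum_eq_zero_iff_of_nonneg fun _ _ => sq_nonneg _] at this
          ext i; simpa using this i (Finset.mem_univ i)
        subst z1 z2
        simp; positivity
      · refine (hKLip h1 h2 h0 (hle.trans (div_le_self (Real.sqrt_nonneg _) hn1))).trans ?_
        gcongr)
  rw [← cubeMeasure_prod] at h
  refine (le_of_eq (lintegral_congr_ae ?_)).trans (h.trans (le_of_eq ?_))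
  · filter_upwards [hae] with z ⟨hz1, hz2⟩
    obtain ⟨a1, a2, a3, a4⟩ := cell_props d n hn z.1 hz1
    obtain ⟨b1, b2, b3, b4⟩ := cell_props d n hn z.2 hz2
    rw [Measure.volume_eq_prod, setIntegral_prod _ (hKi.mono_set (prod_mono a1 b1))]
    simp only [cellAvgKer, Function.uncurry, mul_assoc]
  · rw [Measure.volume_eq_prod, Measure.prod_prod, hBox_vol, ← ENNReal.ofReal_mul (by positivity),
      ← ENNReal.ofReal_mul (by positivity), ← ENNReal.ofReal_mul (by positivity)]
    congr 1
    rw [Real.div_rpow (by positivity) hn0.le, Real.rpow_neg hn0.le]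
    simp only [mul_pow, div_pow]
    field_simp

lemma cellAvgKer_eq (d n : ℕ) (K : (Fin d → ℝ) → (Fin d → ℝ) → ℝ) :
    ∃ F : (Fin d → ℤ) × (Fin d → ℤ) → ℝ, ∀ x y,
      cellAvgKer d n K x y = F (fun l => ⌈(n:ℝ) * x l⌉, fun l => ⌈(n:ℝ) * y l⌉) :=
  ⟨fun p => (n : ℝ) ^ d * ((n : ℝ) ^ d *
    ∫ z in Set.univ.pi fun l => Set.Ioc (((p.1 l : ℝ) - 1) / n) ((p.1 l : ℝ) / n),
    ∫ z' in Set.univ.pi fun l => Set.Ioc (((p.2 l : ℝ) - 1) / n) ((p.2 l : ℝ) / n), K z z'), fun _ _ => rfl⟩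

lemma cellAvgKer_meas (d n : ℕ) (K : (Fin d → ℝ) → (Fin d → ℝ) → ℝ) :
    Measurable (Function.uncurry (cellAvgKer d n K)) := by
  obtain ⟨F, hF⟩ := cellAvgKer_eq d n K
  have : Function.uncurry (cellAvgKer d n K) = F ∘ fun z : (Fin d → ℝ) × (Fin d → ℝ) =>
      (fun l => ⌈(n:ℝ) * z.1 l⌉, fun l => ⌈(n:ℝ) * z.2 l⌉) := by
    ext z; exact hF _ _
  rw [this]
  refine (measurable_of_countable F).comp ?_
  refine Measurable.prodMk ?_ ?_ <;>
  · refine measurable_pi_lambda _ fun l => ?_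
    refine Int.measurable_ceil.comp ?_
    fun_prop

lemma cellAvgKer_bdd (d n : ℕ) (K : (Fin d → ℝ) → (Fin d → ℝ) → ℝ) :
    ∃ κ : ℝ, ∀ᵐ x ∂cubeMeasure d,
      Integrable (fun y => (cellAvgKer d n K x y) ^ 2) (cubeMeasure d) ∧
        (∫ y, (cellAvgKer d n K x y) ^ 2 ∂cubeMeasure d) ≤ κ := by
  obtain ⟨F, hF⟩ := cellAvgKer_eq d n K
  obtain ⟨M, hM⟩ := ((((Set.finite_Icc (0 : Fin d → ℤ) (fun _ => (n:ℤ))).prod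
    (Set.finite_Icc (0 : Fin d → ℤ) (fun _ => (n:ℤ)))).image fun p => F p ^ 2)).bddAbove
  have hmem : ∀ x ∈ unitCube d, (fun l => ⌈(n:ℝ) * x l⌉) ∈ Icc (0 : Fin d → ℤ) (fun _ => (n:ℤ)) := by
    intro x hx
    refine ⟨fun l => Int.ceil_nonneg (mul_nonneg (by positivity) (hx.1 l)), fun l => Int.ceil_le.2 ?_⟩
    have := mul_le_mul_of_nonneg_left (hx.2 l) (Nat.cast_nonneg (α := ℝ) n)
    simpa using this
  have hin : ∀ᵐ x ∂cubeMeasure d, x ∈ unitCube d := ae_restrict_mem (unitCube_meas d)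
  refine ⟨M, ?_⟩
  filter_upwards [hin] with x hx
  have hb : ∀ᵐ y ∂cubeMeasure d, cellAvgKer d n K x y ^ 2 ≤ M := by
    filter_upwards [hin] with y hy
    rw [hF]
    exact hM ⟨_, ⟨hmem x hx, hmem y hy⟩, rfl⟩
  have hi : Integrable (fun y => (cellAvgKer d n K x y) ^ 2) (cubeMeasure d) := by
    refine Integrable.mono' (integrable_const M) ?_ ?_
    · exact (((cellAvgKer_meas d n K).comp measurable_prodMk_left).pow_const 2).aestronglyMeasurable
    · filter_upwards [hb] with y hy
      rwa [Real.norm_of_nonneg (sq_nonneg _)]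
  refine ⟨hi, (integral_mono_ae hi (integrable_const M) hb).trans (by simp)⟩

end geometry

/-- pathwise rate of convergence of the Galerkin scheme.  If moreover
`g ∈ Lip(α, L²(I^d))` and `K ∈ Lip(β, L²(I^d×I^d))`, then there is a constant `C`,
independent of `n` and of the forcing path `w`, such that
`sup_{t∈[0,T]} ‖u(t) − uⁿ(t)‖ ≤ C max{n^{−α}, n^{−β}, sup_{t∈[0,T]} ‖w(t) − P_n w(t)‖}`. -/
theorem galerkin_rate_of_convergence
    (d : ℕ) (hd : 1 ≤ d) (T : ℝ) (hT : 0 < T)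
    (K : (Fin d → ℝ) → (Fin d → ℝ) → ℝ) (hKmeas : Measurable (Function.uncurry K))
    (K₁ K₂ : ℝ)
    (hK1 : ∀ᵐ x ∂cubeMeasure d,
      Integrable (fun y => (K x y) ^ 2) (cubeMeasure d) ∧
        (∫ y, (K x y) ^ 2 ∂cubeMeasure d) ≤ K₁)
    (hK2 : ∀ᵐ y ∂cubeMeasure d,
      Integrable (fun x => (K x y) ^ 2) (cubeMeasure d) ∧
        (∫ x, (K x y) ^ 2 ∂cubeMeasure d) ≤ K₂)
    (S : ℝ → ℝ → ℝ)
    (A_S L_S : ℝ) (hAS : 0 ≤ A_S) (hLS : 0 ≤ L_S)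
    (hSbound : ∀ a b : ℝ, |S a b| ≤ A_S)
    (hSlip : ∀ a b a' b' : ℝ, |S a b - S a' b'| ≤ L_S * (|a - a'| + |b - b'|))
    (f : ℝ → ℝ → ℝ) (hfcont : Continuous (Function.uncurry f))
    (A_f B_f L_f : ℝ) (hAf : 0 ≤ A_f) (hBf : 0 ≤ B_f) (hLf : 0 ≤ L_f)
    (hfbound : ∀ t ∈ Set.Icc (0:ℝ) T, ∀ v : ℝ, |f t v| ≤ A_f + B_f * |v|)
    (hflip : ∀ t ∈ Set.Icc (0:ℝ) T, ∀ v v' : ℝ, |f t v - f t v'| ≤ L_f * |v - v'|)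
    (g : Lp ℝ 2 (cubeMeasure d))
    (α β : ℝ) (hα : α ∈ Set.Ioc (0:ℝ) 1) (hβ : β ∈ Set.Ioc (0:ℝ) 1)
    (Λg ΛK : ℝ) (hΛg : 0 ≤ Λg) (hΛK : 0 ≤ ΛK)
    -- g ∈ Lip(α, L²(I^d)) with constant Λg
    (hgLip : ∀ h : Fin d → ℝ, 0 < euclNorm d h → euclNorm d h ≤ Real.sqrt d →
      (∫ x in {x | x ∈ unitCube d ∧ x + h ∈ unitCube d},
        ((g : (Fin d → ℝ) → ℝ) (x + h) - (g : (Fin d → ℝ) → ℝ) x) ^ 2) ≤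
          (Λg * euclNorm d h ^ α) ^ 2)
    -- K ∈ Lip(β, L²(I^d × I^d)) = Lip(β, L²(I^{2d})) with constant ΛK
    (hKLip : ∀ h₁ h₂ : Fin d → ℝ,
      0 < Real.sqrt (∑ i, (h₁ i) ^ 2 + ∑ i, (h₂ i) ^ 2) →
      Real.sqrt (∑ i, (h₁ i) ^ 2 + ∑ i, (h₂ i) ^ 2) ≤ Real.sqrt (2 * d) →
      (∫ x in {x | x ∈ unitCube d ∧ x + h₁ ∈ unitCube d},
        ∫ y in {y | y ∈ unitCube d ∧ y + h₂ ∈ unitCube d},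
          (K (x + h₁) (y + h₂) - K x y) ^ 2) ≤
        (ΛK * Real.sqrt (∑ i, (h₁ i) ^ 2 + ∑ i, (h₂ i) ^ 2) ^ β) ^ 2) :
    ∃ C : ℝ, 0 < C ∧
      ∀ n : ℕ, 1 ≤ n →
      ∀ w : ℝ → Lp ℝ 2 (cubeMeasure d), Continuous w →
      ∀ gN : Lp ℝ 2 (cubeMeasure d),
        (gN : (Fin d → ℝ) → ℝ) =ᵐ[cubeMeasure d] cellAvg d n g →
      ∀ wN : ℝ → Lp ℝ 2 (cubeMeasure d),
        (∀ t ∈ Set.Icc (0:ℝ) T,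
          (wN t : (Fin d → ℝ) → ℝ) =ᵐ[cubeMeasure d] cellAvg d n (w t)) →
      ∀ N : ℝ → Lp ℝ 2 (cubeMeasure d) → Lp ℝ 2 (cubeMeasure d),
        (∀ s ∈ Set.Icc (0:ℝ) T, ∀ v : Lp ℝ 2 (cubeMeasure d),
          (N s v : (Fin d → ℝ) → ℝ) =ᵐ[cubeMeasure d]
            fun x => f s (v x) + ∫ y, K x y * S (v x) (v y) ∂cubeMeasure d) →
      ∀ Nn : ℝ → Lp ℝ 2 (cubeMeasure d) → Lp ℝ 2 (cubeMeasure d),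
        (∀ s ∈ Set.Icc (0:ℝ) T, ∀ v : Lp ℝ 2 (cubeMeasure d),
          (Nn s v : (Fin d → ℝ) → ℝ) =ᵐ[cubeMeasure d]
            fun x => f s (v x) + ∫ y, cellAvgKer d n K x y * S (v x) (v y) ∂cubeMeasure d) →
      ∀ u : ℝ → Lp ℝ 2 (cubeMeasure d), ContinuousOn u (Set.Icc 0 T) →
        (∀ t ∈ Set.Icc (0:ℝ) T, u t = g + (∫ s in (0:ℝ)..t, N s (u s)) + w t) →
      ∀ uN : ℝ → Lp ℝ 2 (cubeMeasure d), ContinuousOn uN (Set.Icc 0 T) →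
        (∀ t ∈ Set.Icc (0:ℝ) T, uN t = gN + (∫ s in (0:ℝ)..t, Nn s (uN s)) + wN t) →
      ∀ t ∈ Set.Icc (0:ℝ) T,
        ‖u t - uN t‖ ≤
          C * max ((n : ℝ) ^ (-α)) (max ((n : ℝ) ^ (-β))
            (⨆ t' : Set.Icc (0:ℝ) T, Real.sqrt
              (∫ x, ((w t' : (Fin d → ℝ) → ℝ) x -
                cellAvg d n (w t') x) ^ 2 ∂cubeMeasure d))) := by
  have hScont : Continuous (Function.uncurry S) := by
    have : LipschitzWith (Real.toNNReal (2 * L_S)) (Function.uncurry S) := by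
      refine LipschitzWith.of_dist_le_mul fun p q => ?_
      rw [Real.coe_toNNReal _ (by positivity), Real.dist_eq]
      refine (hSlip p.1 p.2 q.1 q.2).trans ?_
      have h1 : |p.1 - q.1| ≤ dist p q := by rw [Prod.dist_eq, ← Real.dist_eq]; exact le_max_left _ _
      have h2 : |p.2 - q.2| ≤ dist p q := by rw [Prod.dist_eq, ← Real.dist_eq]; exact le_max_right _ _
      have := mul_le_mul_of_nonneg_left (add_le_add h1 h2) hLS
      linarith
    exact this.continuous
  set cg : ℝ := Real.sqrt (2 ^ d) * Λg * Real.sqrt d ^ α with hcg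
  set cK : ℝ := 2 ^ d * ΛK * Real.sqrt (2 * d) ^ β with hcK
  set L : ℝ := L_f + 2 * (L_S * Real.sqrt K₁) with hL
  have hcg0 : 0 ≤ cg := by positivity
  have hcK0 : 0 ≤ cK := by positivity
  have hL0 : 0 ≤ L := by positivity
  refine ⟨(cg + 1 + A_S * cK * T) * Real.exp (L * T), by positivity, ?_⟩
  intro n hn w hw gN hgN wN hwN N hN Nn hNn u hu hueq uN huN huNeq
  set m := max ((n : ℝ) ^ (-α)) (max ((n : ℝ) ^ (-β))
            (⨆ t' : Set.Icc (0:ℝ) T, Real.sqrt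
              (∫ x, ((w t' : (Fin d → ℝ) → ℝ) x -
                cellAvg d n (w t') x) ^ 2 ∂cubeMeasure d))) with hm
  have hm1 : (n : ℝ) ^ (-α) ≤ m := le_max_left _ _
  have hm2 : (n : ℝ) ^ (-β) ≤ m := (le_max_left _ _).trans (le_max_right _ _)
  have hm0 : 0 ≤ m := le_trans (by positivity) hm1
  obtain ⟨κ, hκ⟩ := cellAvgKer_bdd d n K
  have hNc := N_cont K hKmeas K₁ hK1 S A_S L_S hLS hScont hSbound hSlip T f hfcont A_f B_f L_f hLf
    hfbound hflip N hN u hu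
  have hNnc := N_cont (cellAvgKer d n K) (cellAvgKer_meas d n K) κ hκ S A_S L_S hLS hScont hSbound hSlip
    T f hfcont A_f B_f L_f hLf hfbound hflip Nn hNn uN huN
  have hgg : ‖g - gN‖ ≤ cg * m := by
    refine le_trans (Lp_norm_le _ (cg * (n:ℝ) ^ (-α)) (by positivity) ?_)
      (mul_le_mul_of_nonneg_left hm1 hcg0)
    refine le_trans (le_of_eq (lintegral_congr_ae ?_)) (proj_g d n hn g α hα.1 Λg hΛg hgLip)
    filter_upwards [Lp.coeFn_sub g gN, hgN] with x h1 h2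
    rw [h1, Pi.sub_apply, h2]
  have hwsq : ∀ t ∈ Icc (0:ℝ) T, Real.sqrt (∫ x, ((w t : (Fin d → ℝ) → ℝ) x -
      cellAvg d n (w t) x) ^ 2 ∂cubeMeasure d) = ‖w t - wN t‖ := by
    intro t ht
    rw [Lp_norm_eq_sqrt]
    congr 1
    refine integral_congr_ae ?_
    filter_upwards [Lp.coeFn_sub (w t) (wN t), hwN t ht] with x h1 h2
    rw [h1, Pi.sub_apply, h2]
  have hii : ∀ t ∈ Icc (0:ℝ) T, IntervalIntegrable (fun s => N s (u s)) volume 0 t := fun t ht =>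
    (hNc.mono (by rw [uIcc_of_le ht.1]; exact Icc_subset_Icc_right ht.2)).intervalIntegrable
  have hiin : ∀ t ∈ Icc (0:ℝ) T, IntervalIntegrable (fun s => Nn s (uN s)) volume 0 t := fun t ht =>
    (hNnc.mono (by rw [uIcc_of_le ht.1]; exact Icc_subset_Icc_right ht.2)).intervalIntegrable
  have hwNc : ContinuousOn wN (Icc 0 T) := by
    have h1 : ContinuousOn (fun t => ∫ s in (0:ℝ)..t, Nn s (uN s)) (Icc 0 T) := by
      have h2 := hiin T ⟨hT.le, le_rfl⟩
      have := intervalIntegral.continuousOn_primitive_interval' h2 left_mem_uIcc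
      rwa [uIcc_of_le hT.le] at this
    have h3 : ContinuousOn (fun t => uN t - gN - ∫ s in (0:ℝ)..t, Nn s (uN s)) (Icc 0 T) :=
      (huN.sub continuousOn_const).sub h1
    refine h3.congr fun t ht => ?_
    have := huNeq t ht
    show wN t = uN t - gN - ∫ s in (0:ℝ)..t, Nn s (uN s)
    rw [this]; abel
  have hww : ∀ t ∈ Icc (0:ℝ) T, ‖w t - wN t‖ ≤ m := by
    intro t ht
    refine le_trans ?_ ((le_max_right _ _).trans (le_max_right _ _))
    have hbdd : BddAbove (range fun t' : Icc (0:ℝ) T => Real.sqrt (∫ x, ((w t' : (Fin d → ℝ) → ℝ) x -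
        cellAvg d n (w t') x) ^ 2 ∂cubeMeasure d)) := by
      obtain ⟨M, hM⟩ := (isCompact_Icc (a := (0:ℝ)) (b := T)).bddAbove_image
        ((hw.continuousOn.sub hwNc).norm)
      refine ⟨M, ?_⟩
      rintro _ ⟨t', rfl⟩
      simp only
      rw [hwsq t' t'.2]
      exact hM ⟨t', t'.2, rfl⟩
    rw [← hwsq t ht]
    exact le_ciSup hbdd ⟨t, ht⟩
  have hdiff : ∀ s ∈ Icc (0:ℝ) T, ‖N s (u s) - Nn s (uN s)‖ ≤ L * ‖u s - uN s‖ + A_S * cK * m := by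
    intro s hs
    have h1 := N_lip K hKmeas K₁ hK1 S A_S L_S hLS hScont hSbound hSlip (f s) L_f hLf (hflip s hs)
      (N s) (hN s hs) (u s) (uN s)
    have h2 := N_diff K (cellAvgKer d n K) hKmeas (cellAvgKer_meas d n K) (hK1.mono fun x hx => hx.1)
      (hκ.mono fun x hx => hx.1) S A_S hAS hScont hSbound (f s) (N s) (Nn s) (hN s hs) (hNn s hs)
      (cK * (n:ℝ) ^ (-β)) (by positivity)
      (proj_K d n hn K hKmeas (memLp_K d K hKmeas K₁ hK1) β hβ.1 ΛK hΛK hKLip) (uN s)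
    have h3 : A_S * (cK * (n:ℝ) ^ (-β)) ≤ A_S * (cK * m) := by gcongr
    have h4 := norm_sub_le_norm_sub_add_norm_sub (N s (u s)) (N s (uN s)) (Nn s (uN s))
    linarith
  have hφc : ContinuousOn (fun t => ‖u t - uN t‖) (Icc 0 T) := (hu.sub huN).norm
  have hgr := gronwall_int (fun t => ‖u t - uN t‖) T ((cg + 1 + A_S * cK * T) * m) L hL0 hφc (by
    intro t ht
    have hsub : uIcc 0 t ⊆ Icc 0 T := by rw [uIcc_of_le ht.1]; exact Icc_subset_Icc_right ht.2
    have hφi : IntervalIntegrable (fun s => ‖u s - uN s‖) volume 0 t :=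
      (hφc.mono hsub).intervalIntegrable
    have e : u t - uN t = (g - gN) + (w t - wN t) + ∫ s in (0:ℝ)..t, (N s (u s) - Nn s (uN s)) := by
      rw [intervalIntegral.integral_sub (hii t ht) (hiin t ht), hueq t ht, huNeq t ht]
      abel
    have hint : ‖∫ s in (0:ℝ)..t, (N s (u s) - Nn s (uN s))‖ ≤
        ∫ s in (0:ℝ)..t, (L * ‖u s - uN s‖ + A_S * cK * m) := by
      refine intervalIntegral.norm_integral_le_of_norm_le ht.1 ?_ ((hφi.const_mul L).add
        intervalIntegrable_const)
      refine ae_of_all _ fun s hs => hdiff s ⟨hs.1.le, hs.2.trans ht.2⟩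
    rw [intervalIntegral.integral_add (hφi.const_mul L) intervalIntegrable_const,
      intervalIntegral.integral_const_mul, intervalIntegral.integral_const, sub_zero, smul_eq_mul] at hint
    have h5 : t * (A_S * cK * m) ≤ T * (A_S * cK * m) := by
      have := ht.2
      gcongr
    have h6 := norm_add₃_le (a := g - gN) (b := w t - wN t) (c := ∫ s in (0:ℝ)..t, (N s (u s) - Nn s (uN s)))
    have h7 := hww t ht
    rw [e] 
    linarith)
  intro t ht
  refine (hgr t ht).trans ?_
  have h8 : Real.exp (L * t) ≤ Real.exp (L * T) := by
    have := ht.2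
    gcongr
  calc (cg + 1 + A_S * cK * T) * m * Real.exp (L * t)
      ≤ (cg + 1 + A_S * cK * T) * m * Real.exp (L * T) := by gcongr
    _ = _ := by ring
end
end
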